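/- arXiv:2111.14601 — 4 statements merged into one kernel-verified Lean document; each statement's English description precedes it below -/
import Mathlib

section
/- Let μ ≥ 0, c₀ ≥ 0 and set η = μ²/4. Let u(t,x) = ∫₀^∞ m^μ(t,x,y) p⁰(t,x,y) dy. Then for every t > 0 the tempered fractional boundary condition ∫₀^t (∂u/∂s)(s,0) · Π̄_η(t−s) ds + (c₀ + μ/2) · u(t,0) = μ holds, where (∂u/∂s)(s,0) denotes the time derivative of s ↦ u(s,0). -/
open MeasureTheory Real Filter

/-- The Gaussian heat kernel `g(t,z) = exp(-z^2/(4t))/sqrt(4*pi*t)`. -/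
noncomputable def g (t z : ℝ) : ℝ := Real.exp (-z ^ 2 / (4 * t)) / Real.sqrt (4 * Real.pi * t)

/-- The elastic Brownian kernel `p⁰(t,x,y)` with elastic coefficient `c₀`. -/
noncomputable def p0 (c₀ t x y : ℝ) : ℝ :=
  g t (x - y) - g t (x + y)
    + ∫ w in Set.Ioi (0 : ℝ), Real.exp (-c₀ * w) * ((w + x + y) / t) * g t (w + x + y)

/-- The drift factor `m^μ(t,x,y) = exp(-μ²t/4 - (μ/2)(x-y))`. -/
noncomputable def mKer (μ t x y : ℝ) : ℝ := Real.exp (-μ ^ 2 * t / 4 - μ / 2 * (x - y))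

/-- `u(t,x) = ∫₀^∞ m^μ(t,x,y) p⁰(t,x,y) dy`. -/
noncomputable def uFun (μ c₀ t x : ℝ) : ℝ :=
  ∫ y in Set.Ioi (0 : ℝ), mKer μ t x y * p0 c₀ t x y

/-- The tail `Π̄_η(z) = ∫_z^∞ e^{-ηs}/(2√π s^{3/2}) ds` of the tempered 1/2-stable
Lévy measure. -/
noncomputable def PiBar (η z : ℝ) : ℝ :=
  ∫ s in Set.Ioi z, Real.exp (-η * s) / (2 * Real.sqrt Real.pi * s ^ ((3 : ℝ) / 2))

noncomputable def Ef (b t : ℝ) : ℝ := ∫ z in Set.Ioi (0:ℝ), Real.exp (-b * z) * (2 * g t z)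
noncomputable def hf (b t : ℝ) : ℝ := ∫ z in Set.Ioi (0:ℝ), Real.exp (-b * z) * (z / t * g t z)

lemma g_nonneg (t z : ℝ) : 0 ≤ g t z := by unfold g; positivity

lemma sqrt4 (t : ℝ) : Real.sqrt (4 * π * t) = 2 * Real.sqrt (π * t) := by
  rw [show 4 * π * t = 2 ^ 2 * (π * t) by ring, Real.sqrt_mul (by norm_num), Real.sqrt_sq (by norm_num)]

lemma two_g {t : ℝ} (ht : 0 < t) (z : ℝ) :
    2 * g t z = Real.exp (-z ^ 2 / (4 * t)) / Real.sqrt (π * t) := by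
  have : 0 < Real.sqrt (π * t) := by positivity
  unfold g; rw [sqrt4 t]; field_simp

lemma e2g {t : ℝ} (ht : 0 < t) (b z : ℝ) : Real.exp (-b * z) * (2 * g t z) =
    Real.exp (b ^ 2 * t) / Real.sqrt (π * t) * Real.exp (- (1 / (4 * t)) * (z + 2 * b * t) ^ 2) := by
  rw [two_g ht, ← mul_div_assoc, ← Real.exp_add, div_mul_eq_mul_div, ← Real.exp_add]
  congr 2
  field_simp
  ring

lemma int1 {t : ℝ} (ht : 0 < t) (b : ℝ) :
    Integrable (fun z => Real.exp (-b * z) * (2 * g t z)) := by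
  simp_rw [e2g ht b]
  exact ((integrable_exp_neg_mul_sq (by positivity : 0 < 1 / (4 * t))).comp_add_right (2 * b * t)).const_mul _

lemma int2 {t : ℝ} (ht : 0 < t) (b : ℝ) :
    IntegrableOn (fun z => Real.exp (-b * z) * (z / t * g t z)) (Set.Ioi 0) := by
  have h := ((int1 ht (b - 1)).const_mul (1 / (2 * t))).integrableOn (s := Set.Ioi 0)
  refine Integrable.mono' h ?_ ?_
  · apply Continuous.aestronglyMeasurable
    unfold g; fun_prop
  · filter_upwards [ae_restrict_mem measurableSet_Ioi] with z hz
    have hz : 0 < z := hz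
    have hg := g_nonneg t z
    rw [Real.norm_of_nonneg (by positivity)]
    have h1 : Real.exp (-(b - 1) * z) = Real.exp (-b * z) * Real.exp z := by
      rw [← Real.exp_add]; ring_nf
    rw [h1]
    have h2 : z ≤ Real.exp z := by linarith [Real.add_one_le_exp z]
    calc Real.exp (-b * z) * (z / t * g t z) = z * (Real.exp (-b * z) * g t z / t) := by ring
      _ ≤ Real.exp z * (Real.exp (-b * z) * g t z / t) := by gcongr
      _ = _ := by field_simp

lemma shift_Ioi (φ : ℝ → ℝ) (c : ℝ) :
    ∫ x in Set.Ioi (0:ℝ), φ (x + c) = ∫ x in Set.Ioi c, φ x := by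
  have := (measurePreserving_add_right volume c).setIntegral_preimage_emb
    (measurableEmbedding_addRight c) φ (Set.Ioi c)
  rw [← this]; congr 2; simp

lemma Ef_eq {t : ℝ} (ht : 0 < t) (b : ℝ) :
    Ef b t = Real.exp (b ^ 2 * t) *
      (1 - 2 / Real.sqrt π * ∫ x in (0:ℝ)..(b * Real.sqrt t), Real.exp (-x ^ 2)) := by
  have hst : 0 < Real.sqrt t := by positivity
  have hsp : 0 < Real.sqrt π := by positivity
  have hs2 : Real.sqrt t ^ 2 = t := Real.sq_sqrt ht.le
  have h1 : Ef b t = ∫ z in Set.Ioi (0:ℝ), Real.exp (b ^ 2 * t) / Real.sqrt (π * t) *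
      (fun x => (fun y => Real.exp (-y ^ 2)) (x + b * Real.sqrt t)) ((1 / (2 * Real.sqrt t)) * z) := by
    unfold Ef
    refine integral_congr_ae (ae_of_all _ fun z => ?_)
    simp only [e2g ht b]
    congr 2
    conv_lhs => rw [← hs2]
    field_simp
    norm_num
  have hI : Integrable (fun x : ℝ => Real.exp (-x ^ 2)) := by
    simpa using integrable_exp_neg_mul_sq (one_pos)
  have h2 := intervalIntegral.integral_interval_add_Ioi (a := 0) (b := b * Real.sqrt t)
     (f := fun x => Real.exp (-x ^ 2)) (μ := volume) hI.integrableOn hI.integrableOn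
  have h3 : ∫ x in Set.Ioi (0:ℝ), Real.exp (-x ^ 2) = Real.sqrt π / 2 := by
    simpa using integral_gaussian_Ioi 1
  rw [h1, integral_const_mul,
    integral_comp_mul_left_Ioi (fun x => (fun y => Real.exp (-y ^ 2)) (x + b * Real.sqrt t)) 0
      (by positivity : 0 < 1 / (2 * Real.sqrt t)), mul_zero,
    shift_Ioi (fun y => Real.exp (-y ^ 2))]
  rw [h3] at h2
  rw [← eq_sub_iff_add_eq'] at h2
  rw [h2, Real.sqrt_mul (by positivity), smul_eq_mul]
  field_simp

lemma Ef_add {t : ℝ} (ht : 0 < t) (b : ℝ) : Ef b t + Ef (-b) t = 2 * Real.exp (b ^ 2 * t) := by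
  have h : ∫ x in (0:ℝ)..(-b * Real.sqrt t), Real.exp (-x ^ 2)
      = - ∫ x in (0:ℝ)..(b * Real.sqrt t), Real.exp (-x ^ 2) := by
    have := intervalIntegral.integral_comp_neg (a := 0) (b := b * Real.sqrt t) (fun x => Real.exp (-x ^ 2))
    simp only [neg_sq, neg_zero] at this
    rw [this, intervalIntegral.integral_symm, neg_mul]
  rw [Ef_eq ht, Ef_eq ht, h, neg_sq]; ring

lemma Ef_deriv {t : ℝ} (ht : 0 < t) (b : ℝ) :
    HasDerivAt (Ef b) (b ^ 2 * Ef b t - b / Real.sqrt (π * t)) t := by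
  have hst : 0 < Real.sqrt t := by positivity
  have hsp : 0 < Real.sqrt π := by positivity
  have hs2 : Real.sqrt t ^ 2 = t := Real.sq_sqrt ht.le
  have hc : Continuous (fun x : ℝ => Real.exp (-x ^ 2)) := by fun_prop
  have h1 : HasDerivAt (fun y => ∫ x in (0:ℝ)..y, Real.exp (-x ^ 2)) (Real.exp (-(b * Real.sqrt t) ^ 2)) (b * Real.sqrt t) :=
    intervalIntegral.integral_hasDerivAt_right (hc.intervalIntegrable _ _)
      hc.aestronglyMeasurable.stronglyMeasurableAtFilter hc.continuousAt
  have h2 := h1.comp t (((Real.hasDerivAt_sqrt ht.ne').const_mul b))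
  have h3 : HasDerivAt (fun s => Real.exp (b ^ 2 * s)) (Real.exp (b ^ 2 * t) * (b ^ 2)) t := by
    simpa using ((hasDerivAt_id t).const_mul (b ^ 2)).exp
  have h4 := h3.mul ((h2.const_mul (2 / Real.sqrt π)).const_sub 1)
  have h5 : Ef b =ᶠ[nhds t] (fun t => Real.exp (b ^ 2 * t) *
      (1 - 2 / Real.sqrt π * ∫ x in (0:ℝ)..(b * Real.sqrt t), Real.exp (-x ^ 2))) := by
    filter_upwards [lt_mem_nhds ht] with s hs using Ef_eq hs b
  refine (h4.congr_of_eventuallyEq h5).congr_deriv ?_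
  rw [Ef_eq ht]
  have h6 : Real.exp (-(b * Real.sqrt t) ^ 2) = (Real.exp (b ^ 2 * t))⁻¹ := by
    rw [← Real.exp_neg, mul_pow, hs2]
  have := Real.exp_pos (b ^ 2 * t)
  rw [h6, Real.sqrt_mul (by positivity)]
  simp only [Function.comp]
  field_simp
  ring

lemma g_deriv {t : ℝ} (ht : 0 < t) (b z : ℝ) :
    HasDerivAt (fun z => Real.exp (-b * z) * (2 * g t z))
      (-b * (Real.exp (-b * z) * (2 * g t z)) - Real.exp (-b * z) * (z / t * g t z)) z := by
  have h1 : HasDerivAt (fun z => Real.exp (-b * z)) (Real.exp (-b * z) * (-b)) z := by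
    simpa using ((hasDerivAt_id z).const_mul (-b)).exp
  have h2 : HasDerivAt (fun z => g t z) (- (z / (2 * t)) * g t z) z := by
    have := ((((hasDerivAt_id z).pow 2).neg.div_const (4 * t)).exp).div_const (Real.sqrt (4 * π * t))
    refine this.congr_deriv ?_
    unfold g
    simp
    field_simp
    norm_num
  refine (h1.mul (h2.const_mul 2)).congr_deriv ?_
  field_simp
  ring

lemma Tf_eq {t : ℝ} (ht : 0 < t) (b : ℝ) {y : ℝ} (hy : 0 ≤ y) :
    ∫ z in Set.Ioi y, Real.exp (-b * z) * (z / t * g t z) =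
      Real.exp (-b * y) * (2 * g t y) - b * ∫ z in Set.Ioi y, Real.exp (-b * z) * (2 * g t z) := by
  have hA := (int1 ht b).integrableOn (s := Set.Ioi y)
  have hB : IntegrableOn (fun z => Real.exp (-b * z) * (z / t * g t z)) (Set.Ioi y) :=
    (int2 ht b).mono_set (Set.Ioi_subset_Ioi hy)
  have hint : IntegrableOn (fun z => -b * (Real.exp (-b * z) * (2 * g t z))
      - Real.exp (-b * z) * (z / t * g t z)) (Set.Ioi y) := (hA.const_mul (-b)).sub hB
  have h0 := tendsto_zero_of_hasDerivAt_of_integrableOn_Ioi (fun z _ => g_deriv ht b z) hint hA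
  have := integral_Ioi_of_hasDerivAt_of_tendsto' (fun z _ => g_deriv ht b z) hint h0
  rw [integral_sub (hA.const_mul (-b)) hB, integral_const_mul] at this
  linarith

lemma hf_eq {t : ℝ} (ht : 0 < t) (b : ℝ) : hf b t = 1 / Real.sqrt (π * t) - b * Ef b t := by
  unfold hf Ef
  rw [Tf_eq ht b le_rfl, two_g ht]
  simp

lemma Ef_nonneg (b t : ℝ) : 0 ≤ Ef b t :=
  integral_nonneg fun z => mul_nonneg (Real.exp_pos _).le (mul_nonneg (by norm_num) (g_nonneg t z))

lemma hf_nonneg (b : ℝ) {t : ℝ} (ht : 0 < t) : 0 ≤ hf b t :=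
  setIntegral_nonneg measurableSet_Ioi fun z hz =>
    mul_nonneg (Real.exp_pos _).le (mul_nonneg (div_nonneg (le_of_lt hz) ht.le) (g_nonneg t z))

lemma rpow32 {s : ℝ} (hs : 0 < s) : s ^ ((3:ℝ)/2) = s * Real.sqrt s := by
  rw [show (3:ℝ)/2 = 1 + 1/2 by norm_num, Real.rpow_add hs, Real.rpow_one, Real.sqrt_eq_rpow]

lemma PiBar_eq {a z : ℝ} (ha : 0 ≤ a) (hz : 0 < z) :
    PiBar (a ^ 2) z = Real.exp (-a ^ 2 * z) * hf a z := by
  have hd : ∀ s ∈ Set.Ici z, HasDerivAt (fun s => Real.exp (-a ^ 2 * s) * (1 / Real.sqrt (π * s) - a * Ef a s))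
      (- (Real.exp (-a ^ 2 * s) / (2 * Real.sqrt Real.pi * s ^ ((3 : ℝ) / 2)))) s := by
    intro s hs
    have hs : 0 < s := lt_of_lt_of_le hz hs
    have hss : 0 < Real.sqrt s := by positivity
    have hsp : 0 < Real.sqrt π := by positivity
    have hs2 : Real.sqrt s ^ 2 = s := Real.sq_sqrt hs.le
    have h1 : HasDerivAt (fun s => Real.exp (-a ^ 2 * s)) (Real.exp (-a ^ 2 * s) * (-a ^ 2)) s := by
      simpa using ((hasDerivAt_id s).const_mul (-a ^ 2)).exp
    have h2 : HasDerivAt (fun s => 1 / Real.sqrt (π * s)) (- (1 / (2 * Real.sqrt π * (s * Real.sqrt s)))) s := by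
      have h3 := (((Real.hasDerivAt_sqrt hs.ne').const_mul (Real.sqrt π)).inv (by positivity))
      have h4 : (fun s => 1 / Real.sqrt (π * s)) = (fun s => (Real.sqrt π * Real.sqrt s)⁻¹) := by
        funext s; rw [Real.sqrt_mul (by positivity), one_div]
      rw [h4]
      refine h3.congr_deriv ?_
      rw [mul_pow, hs2]
      field_simp
    refine (h1.mul (h2.sub ((Ef_deriv hs a).const_mul a))).congr_deriv ?_
    simp only [Pi.sub_apply]
    rw [rpow32 hs, Real.sqrt_mul (by positivity)]
    field_simp
    ring
  have hlim : Tendsto (fun s => Real.exp (-a ^ 2 * s) * (1 / Real.sqrt (π * s) - a * Ef a s)) atTop (nhds 0) := by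
    have h1 : Tendsto (fun s => 1 / Real.sqrt (π * s)) atTop (nhds 0) := by
      simp_rw [one_div]
      exact (Real.tendsto_sqrt_atTop.comp (tendsto_id.const_mul_atTop Real.pi_pos)).inv_tendsto_atTop
    refine tendsto_of_tendsto_of_tendsto_of_le_of_le' tendsto_const_nhds h1 ?_ ?_
    · filter_upwards [eventually_gt_atTop 0] with s hs
      rw [← hf_eq hs]
      exact mul_nonneg (Real.exp_pos _).le (hf_nonneg a hs)
    · filter_upwards [eventually_gt_atTop 0] with s hs
      have h2 := hf_nonneg a hs
      have h3 : Real.exp (-a ^ 2 * s) ≤ 1 := by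
        rw [Real.exp_le_one_iff]; nlinarith [sq_nonneg a]
      have h4 : hf a s ≤ 1 / Real.sqrt (π * s) := by
        rw [hf_eq hs]; linarith [mul_nonneg ha (Ef_nonneg a s)]
      rw [← hf_eq hs]
      nlinarith
  have := integral_Ioi_of_hasDerivAt_of_nonpos' hd (fun s hs => by
    have hs : 0 < s := lt_trans hz hs
    have : 0 ≤ Real.exp (-a ^ 2 * s) / (2 * Real.sqrt Real.pi * s ^ ((3 : ℝ) / 2)) := by positivity
    linarith) hlim
  rw [integral_neg] at this
  unfold PiBar
  rw [hf_eq hz]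
  linarith

noncomputable def Tf (c t y : ℝ) : ℝ := ∫ z in Set.Ioi y, Real.exp (-c * z) * (z / t * g t z)

lemma Tf_deriv (t c y : ℝ) :
    HasDerivAt (fun y => hf c t - ∫ z in (0:ℝ)..y, Real.exp (-c * z) * (z / t * g t z))
      (-(Real.exp (-c * y) * (y / t * g t y))) y := by
  have hc : Continuous (fun z => Real.exp (-c * z) * (z / t * g t z)) := by
    unfold g; fun_prop
  exact (intervalIntegral.integral_hasDerivAt_right (hc.intervalIntegrable _ _)
      hc.aestronglyMeasurable.stronglyMeasurableAtFilter hc.continuousAt).const_sub _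

lemma Tf_int {t : ℝ} (ht : 0 < t) (c : ℝ) {y : ℝ} (hy : 0 ≤ y) :
    Tf c t y = hf c t - ∫ z in (0:ℝ)..y, Real.exp (-c * z) * (z / t * g t z) := by
  have h2 := intervalIntegral.integral_interval_add_Ioi (a := 0) (b := y)
     (f := fun z => Real.exp (-c * z) * (z / t * g t z)) (μ := volume) (int2 ht c)
     ((int2 ht c).mono_set (Set.Ioi_subset_Ioi hy))
  unfold Tf hf
  linarith

lemma Tf_nonneg {t : ℝ} (ht : 0 < t) (c : ℝ) {y : ℝ} (hy : 0 ≤ y) : 0 ≤ Tf c t y :=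
  setIntegral_nonneg measurableSet_Ioi fun z hz =>
    mul_nonneg (Real.exp_pos _).le (mul_nonneg (div_nonneg (hy.trans (le_of_lt hz)) ht.le) (g_nonneg t z))

lemma Tf_le {t : ℝ} (ht : 0 < t) {c : ℝ} (hc : 0 ≤ c) {y : ℝ} (hy : 0 ≤ y) :
    Tf c t y ≤ Real.exp (-c * y) * (2 * g t y) := by
  unfold Tf
  rw [Tf_eq ht c hy]
  have : 0 ≤ ∫ z in Set.Ioi y, Real.exp (-c * z) * (2 * g t z) :=
    integral_nonneg fun z => mul_nonneg (Real.exp_pos _).le (mul_nonneg (by norm_num) (g_nonneg t z))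
  nlinarith

lemma uFun_eq (μ c t : ℝ) :
    uFun μ c t 0 = Real.exp (-(μ / 2) ^ 2 * t) *
      ∫ y in Set.Ioi (0:ℝ), Real.exp ((μ / 2 + c) * y) * Tf c t y := by
  unfold uFun
  rw [← integral_const_mul]
  refine setIntegral_congr_fun measurableSet_Ioi fun y _ => ?_
  have hp : p0 c t 0 y = Real.exp (c * y) * Tf c t y := by
    unfold p0 Tf
    have : g t (0 - y) = g t (0 + y) := by unfold g; simp
    rw [this, sub_self, zero_add, ← integral_const_mul,
      ← shift_Ioi (fun z => Real.exp (c * y) * (Real.exp (-c * z) * (z / t * g t z))) y]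
    refine integral_congr_ae (ae_of_all _ fun w => ?_)
    simp only [add_zero]
    rw [← mul_assoc (Real.exp (c * y)), ← Real.exp_add, mul_assoc]
    congr 2; ring
  change mKer μ t 0 y * p0 c t 0 y = _
  rw [hp]
  unfold mKer
  rw [← mul_assoc, ← mul_assoc, ← Real.exp_add, ← Real.exp_add]
  congr 2; ring

lemma A_eq {a c t : ℝ} (hc : 0 ≤ c) (ht : 0 < t) :
    (a + c) * ∫ y in Set.Ioi (0:ℝ), Real.exp ((a + c) * y) * Tf c t y = hf (-a) t - hf c t := by
  set G : ℝ → ℝ := fun y => Real.exp ((a + c) * y) *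
    (hf c t - ∫ z in (0:ℝ)..y, Real.exp (-c * z) * (z / t * g t z)) with hG
  have hGT : ∀ y, 0 ≤ y → G y = Real.exp ((a + c) * y) * Tf c t y := fun y hy => by
    rw [hG, Tf_int ht c hy]
  have hGd : ∀ y ∈ Set.Ici (0:ℝ), HasDerivAt G
      ((a + c) * G y - Real.exp (- -a * y) * (y / t * g t y)) y := by
    intro y hy
    have h1 : HasDerivAt (fun s => Real.exp ((a + c) * s)) (Real.exp ((a + c) * y) * (a + c)) y := by
      simpa using ((hasDerivAt_id y).const_mul (a + c)).exp
    refine (h1.mul (Tf_deriv t c y)).congr_deriv ?_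
    have : Real.exp (- -a * y) = Real.exp ((a + c) * y) * Real.exp (-c * y) := by
      rw [← Real.exp_add]; congr 1; ring
    rw [this, hG]; ring
  have hGi : IntegrableOn G (Set.Ioi 0) := by
    refine Integrable.mono' ((int1 ht (-a)).integrableOn) ?_ ?_
    · refine ContinuousOn.aestronglyMeasurable (fun y hy => ?_) measurableSet_Ioi
      exact (hGd y (Set.Ioi_subset_Ici_self hy)).continuousAt.continuousWithinAt
    · filter_upwards [ae_restrict_mem measurableSet_Ioi] with y hy
      have hy : 0 ≤ y := le_of_lt hy
      have h1 := Tf_nonneg ht c hy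
      rw [hGT y hy, Real.norm_of_nonneg (by positivity)]
      have : Real.exp (- -a * y) = Real.exp ((a + c) * y) * Real.exp (-c * y) := by
        rw [← Real.exp_add]; congr 1; ring
      rw [this, mul_assoc]
      gcongr
      exact Tf_le ht hc hy
  have hint : IntegrableOn (fun y => (a + c) * G y - Real.exp (- -a * y) * (y / t * g t y)) (Set.Ioi 0) :=
    (hGi.const_mul _).sub (int2 ht (-a))
  have h0 := tendsto_zero_of_hasDerivAt_of_integrableOn_Ioi (fun z hz => hGd z (Set.Ioi_subset_Ici_self hz)) hint hGi
  have := integral_Ioi_of_hasDerivAt_of_tendsto' hGd hint h0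
  rw [integral_sub (hGi.const_mul _) (int2 ht (-a)), integral_const_mul] at this
  have hG0 : G 0 = hf c t := by simp [hG]
  have hGI : ∫ y in Set.Ioi (0:ℝ), G y = ∫ y in Set.Ioi (0:ℝ), Real.exp ((a + c) * y) * Tf c t y :=
    setIntegral_congr_fun measurableSet_Ioi fun y hy => hGT y (le_of_lt hy)
  rw [← hGI]
  rw [hG0] at this
  have hh : hf (-a) t = ∫ z in Set.Ioi (0:ℝ), Real.exp (- -a * z) * (z / t * g t z) := rfl
  rw [hh]; linarith

lemma u_formula {μ c t : ℝ} (hc : 0 ≤ c) (ht : 0 < t) :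
    (μ / 2 + c) * uFun μ c t 0 = μ + Real.exp (-(μ / 2) ^ 2 * t) * (c * Ef c t - μ / 2 * Ef (μ / 2) t) := by
  rw [uFun_eq, mul_left_comm, A_eq hc ht, hf_eq ht, hf_eq ht]
  have h := Ef_add ht (μ / 2)
  have h2 : Real.exp (-(μ / 2) ^ 2 * t) * Real.exp ((μ / 2) ^ 2 * t) = 1 := by
    rw [← Real.exp_add]; simp
  have h3 : Ef (-(μ/2)) t = 2 * Real.exp ((μ / 2) ^ 2 * t) - Ef (μ/2) t := by linarith
  rw [h3]
  linear_combination μ * h2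

lemma u_zero {t : ℝ} (ht : 0 < t) : uFun 0 0 t 0 = 1 := by
  rw [uFun_eq]
  have h1 : ∫ y in Set.Ioi (0:ℝ), Real.exp ((0 / 2 + 0) * y) * Tf 0 t y = Ef 0 t := by
    unfold Ef
    refine setIntegral_congr_fun measurableSet_Ioi fun y hy => ?_
    unfold Tf
    rw [Tf_eq ht 0 (le_of_lt hy)]
    simp
  have h2 := Ef_add ht 0
  simp at h2
  rw [h1]
  simp
  linarith

lemma u_deriv {μ c s : ℝ} (hμ : 0 ≤ μ) (hc : 0 ≤ c) (hs : 0 < s) :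
    deriv (fun τ => uFun μ c τ 0) s = (μ / 2 - c) * (Real.exp (-(μ / 2) ^ 2 * s) * hf c s) := by
  rcases eq_or_lt_of_le (by positivity : 0 ≤ μ / 2 + c) with h0 | h0
  · have hm : μ = 0 := by linarith
    have hc0 : c = 0 := by linarith
    subst hm hc0
    have : (fun τ => uFun 0 0 τ 0) =ᶠ[nhds s] fun _ => 1 := by
      filter_upwards [lt_mem_nhds hs] with r hr using u_zero hr
    rw [this.deriv_eq]; simp
  · have h1 : HasDerivAt (fun s => Real.exp (-(μ / 2) ^ 2 * s)) (Real.exp (-(μ / 2) ^ 2 * s) * (-(μ / 2) ^ 2)) s := by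
      simpa using ((hasDerivAt_id s).const_mul (-(μ / 2) ^ 2)).exp
    have h2 := ((h1.mul (((Ef_deriv hs c).const_mul c).sub ((Ef_deriv hs (μ / 2)).const_mul (μ / 2)))).const_add μ).div_const (μ / 2 + c)
    have h3 : (fun τ => uFun μ c τ 0) =ᶠ[nhds s] fun t => (μ + Real.exp (-(μ / 2) ^ 2 * t) * (c * Ef c t - μ / 2 * Ef (μ / 2) t)) / (μ / 2 + c) := by
      filter_upwards [lt_mem_nhds hs] with r hr
      rw [← u_formula hc hr, mul_div_cancel_left₀ _ h0.ne']
    rw [(h2.congr_of_eventuallyEq h3).deriv, hf_eq hs, div_eq_iff h0.ne']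
    simp only [Pi.sub_apply]
    ring

open scoped ENNReal

lemma inner_sub {t z : ℝ} (ht : 0 < t) (hz : 0 < z) :
    ∫⁻ s in Set.Ioo 0 t, ENNReal.ofReal (z / s * g s z) * ENNReal.ofReal (1 / Real.sqrt (π * (t - s)))
      = ENNReal.ofReal (2 * g t z) := by
  have himg : (fun r : ℝ => t / (1 + t * r ^ 2)) '' Set.Ioi 0 = Set.Ioo 0 t := by
    ext s
    simp only [Set.mem_image, Set.mem_Ioi, Set.mem_Ioo]
    constructor
    · rintro ⟨r, hr, rfl⟩
      refine ⟨by positivity, ?_⟩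
      rw [div_lt_iff₀ (by positivity)]
      have : 0 < t * (t * r ^ 2) := by positivity
      nlinarith
    · rintro ⟨h0, h1⟩
      have h2 : 0 < (t - s) / (s * t) := div_pos (by linarith) (by positivity)
      refine ⟨Real.sqrt ((t - s) / (s * t)), by positivity, ?_⟩
      rw [Real.sq_sqrt h2.le]
      field_simp
      ring
  have hinj : Set.InjOn (fun r : ℝ => t / (1 + t * r ^ 2)) (Set.Ioi 0) := by
    intro x hx y hy h
    have hx : 0 < x := hx
    have hy : 0 < y := hy
    simp only at h
    rw [div_eq_div_iff (by positivity) (by positivity)] at h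
    have h1 : t * t * (x ^ 2 - y ^ 2) = 0 := by linear_combination (-1:ℝ) * h
    have h2 : x ^ 2 - y ^ 2 = 0 := by
      rcases mul_eq_zero.1 h1 with h | h
      · exact absurd h (by positivity)
      · exact h
    nlinarith
  have hder : ∀ r ∈ Set.Ioi (0:ℝ), HasDerivWithinAt (fun r : ℝ => t / (1 + t * r ^ 2))
      (- (2 * t ^ 2 * r / (1 + t * r ^ 2) ^ 2)) (Set.Ioi 0) r := by
    intro r hr
    have hr : 0 < r := hr
    have h1 : HasDerivAt (fun r : ℝ => 1 + t * r ^ 2) (t * (2 * r)) r := by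
      simpa using ((hasDerivAt_pow 2 r).const_mul t).const_add 1
    have h2 := ((hasDerivAt_const r t).div h1 (by positivity)).hasDerivWithinAt (s := Set.Ioi 0)
    refine h2.congr_deriv ?_
    field_simp
    ring
  rw [← himg, lintegral_image_eq_lintegral_abs_deriv_mul measurableSet_Ioi hder hinj]
  have hst : 0 < Real.sqrt t := by positivity
  have hsp : 0 < Real.sqrt π := by positivity
  have hs2 : Real.sqrt t ^ 2 = t := Real.sq_sqrt ht.le
  have hp2 : Real.sqrt π ^ 2 = π := Real.sq_sqrt Real.pi_pos.le
  have hpt : ∀ r ∈ Set.Ioi (0:ℝ), ENNReal.ofReal |- (2 * t ^ 2 * r / (1 + t * r ^ 2) ^ 2)| *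
      (ENNReal.ofReal (z / (t / (1 + t * r ^ 2)) * g (t / (1 + t * r ^ 2)) z) *
        ENNReal.ofReal (1 / Real.sqrt (π * (t - t / (1 + t * r ^ 2)))))
      = ENNReal.ofReal (z / (π * Real.sqrt t) * Real.exp (-z ^ 2 / (4 * t)) * Real.exp (-(z ^ 2 / 4) * r ^ 2)) := by
    intro r hr
    have hr : 0 < r := hr
    have hg := g_nonneg (t / (1 + t * r ^ 2)) z
    rw [abs_neg, abs_of_nonneg (by positivity), ← ENNReal.ofReal_mul (by positivity),
      ← ENNReal.ofReal_mul (by positivity)]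
    congr 1
    obtain ⟨D, hD, hD2⟩ : ∃ D : ℝ, 0 < D ∧ 1 + t * r ^ 2 = D ^ 2 :=
      ⟨Real.sqrt (1 + t * r ^ 2), by positivity, (Real.sq_sqrt (by positivity)).symm⟩
    have e1 : Real.sqrt (π * (t - t / D ^ 2)) = Real.sqrt π * (t * r / D) := by
      have : π * (t - t / D ^ 2) = (Real.sqrt π * (t * r / D)) ^ 2 := by
        rw [mul_pow, hp2]
        field_simp
        linear_combination (-1:ℝ) * hD2
      rw [this, Real.sqrt_sq (by positivity)]
    have e2 : Real.sqrt (4 * π * (t / D ^ 2)) = 2 * Real.sqrt π * Real.sqrt t / D := by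
      have : 4 * π * (t / D ^ 2) = (2 * Real.sqrt π * Real.sqrt t / D) ^ 2 := by
        rw [div_pow, mul_pow, mul_pow, hp2, hs2]; ring
      rw [this, Real.sqrt_sq (by positivity)]
    have e3 : Real.exp (-z ^ 2 / (4 * t)) * Real.exp (-(z ^ 2 / 4) * r ^ 2) = Real.exp (-z ^ 2 / (4 * (t / D ^ 2))) := by
      rw [← Real.exp_add]; congr 1
      field_simp
      linear_combination (-1:ℝ) * hD2
    rw [mul_assoc (z / (π * Real.sqrt t)), e3, hD2, e1]
    unfold g
    rw [e2]
    conv_rhs => rw [← hp2]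
    field_simp
  rw [setLIntegral_congr_fun measurableSet_Ioi hpt]
  have hI : Integrable (fun r : ℝ => Real.exp (-(z ^ 2 / 4) * r ^ 2)) :=
    integrable_exp_neg_mul_sq (by positivity)
  rw [← ofReal_integral_eq_lintegral_ofReal (hI.integrableOn.const_mul _)
    (ae_of_all _ fun r => by positivity), integral_const_mul, integral_gaussian_Ioi]
  congr 1
  have e4 : Real.sqrt (π / (z ^ 2 / 4)) = 2 * Real.sqrt π / z := by
    have : π / (z ^ 2 / 4) = (2 * Real.sqrt π / z) ^ 2 := by
      rw [div_pow, mul_pow, hp2]; field_simp; norm_num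
    rw [this, Real.sqrt_sq (by positivity)]
  rw [e4, two_g ht, Real.sqrt_mul (by positivity)]
  conv_lhs => rw [← hp2]
  field_simp
  rw [hp2]

lemma conv_ind (F G : ℝ → ℝ≥0∞) (t : ℝ) :
    lconvolution ((Set.Ioi 0).indicator F) ((Set.Ioi 0).indicator G) volume t
      = ∫⁻ s in Set.Ioo 0 t, F s * G (t - s) := by
  rw [lconvolution_def, ← lintegral_indicator measurableSet_Ioo]
  refine lintegral_congr fun s => ?_
  by_cases h1 : 0 < s
  · by_cases h2 : s < t
    · rw [Set.indicator_of_mem (by exact h1), Set.indicator_of_mem (by simpa using h2),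
        Set.indicator_of_mem (by exact ⟨h1, h2⟩), neg_add_eq_sub]
    · rw [Set.indicator_of_notMem (s := Set.Ioi 0) (a := -s + t) (by simpa using h2),
        Set.indicator_of_notMem (s := Set.Ioo 0 t) (fun h => h2 h.2), mul_zero]
  · rw [Set.indicator_of_notMem (s := Set.Ioi 0) (a := s) (by simpa using h1),
        Set.indicator_of_notMem (s := Set.Ioo 0 t) (fun h => h1 h.1), zero_mul]

noncomputable def hL (b s : ℝ) : ℝ≥0∞ :=
  ∫⁻ z in Set.Ioi (0:ℝ), ENNReal.ofReal (Real.exp (-b * z) * (z / s * g s z))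
noncomputable def eL (b s : ℝ) : ℝ≥0∞ :=
  ∫⁻ z in Set.Ioi (0:ℝ), ENNReal.ofReal (Real.exp (-b * z) * (2 * g s z))
noncomputable def kL (s : ℝ) : ℝ≥0∞ := ENNReal.ofReal (1 / Real.sqrt (π * s))

lemma hL_eq (b : ℝ) {s : ℝ} (hs : 0 < s) : hL b s = ENNReal.ofReal (hf b s) := by
  unfold hL hf
  rw [ofReal_integral_eq_lintegral_ofReal (int2 hs b)]
  filter_upwards [ae_restrict_mem measurableSet_Ioi] with z hz
  exact mul_nonneg (Real.exp_pos _).le (mul_nonneg (div_nonneg (le_of_lt hz) hs.le) (g_nonneg s z))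

lemma eL_eq (b : ℝ) {s : ℝ} (hs : 0 < s) : eL b s = ENNReal.ofReal (Ef b s) := by
  unfold eL Ef
  rw [ofReal_integral_eq_lintegral_ofReal (int1 hs b).integrableOn]
  exact ae_of_all _ fun z => mul_nonneg (Real.exp_pos _).le (mul_nonneg (by norm_num) (g_nonneg s z))

lemma hL_meas (b : ℝ) : Measurable (hL b) := by
  unfold hL g
  apply Measurable.lintegral_prod_right'
    (f := fun p : ℝ × ℝ => ENNReal.ofReal (Real.exp (-b * p.2) * (p.2 / p.1 * (Real.exp (-p.2 ^ 2 / (4 * p.1)) / Real.sqrt (4 * Real.pi * p.1)))))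
  fun_prop

lemma eL_meas (b : ℝ) : Measurable (eL b) := by
  unfold eL g
  apply Measurable.lintegral_prod_right'
    (f := fun p : ℝ × ℝ => ENNReal.ofReal (Real.exp (-b * p.2) * (2 * (Real.exp (-p.2 ^ 2 / (4 * p.1)) / Real.sqrt (4 * Real.pi * p.1)))))
  fun_prop

lemma kL_meas : Measurable kL := by unfold kL; fun_prop

noncomputable def hI (b : ℝ) : ℝ → ℝ≥0∞ := (Set.Ioi 0).indicator (hL b)
noncomputable def eI (b : ℝ) : ℝ → ℝ≥0∞ := (Set.Ioi 0).indicator (eL b)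
noncomputable def kI : ℝ → ℝ≥0∞ := (Set.Ioi 0).indicator kL

lemma hI_meas (b : ℝ) : Measurable (hI b) := (hL_meas b).indicator measurableSet_Ioi
lemma eI_meas (b : ℝ) : Measurable (eI b) := (eL_meas b).indicator measurableSet_Ioi
lemma kI_meas : Measurable kI := kL_meas.indicator measurableSet_Ioi

lemma h_conv_k (b : ℝ) : lconvolution (hI b) kI volume = eI b := by
  funext t
  unfold hI kI
  rw [conv_ind]
  unfold eI
  by_cases ht : 0 < t
  · rw [Set.indicator_of_mem (by exact ht)]
    unfold hL eL
    have hm : ∀ s, Measurable fun z => ENNReal.ofReal (Real.exp (-b * z) * (z / s * g s z)) := by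
      intro s; unfold g; fun_prop
    simp_rw [← lintegral_mul_const _ (hm _)]
    rw [lintegral_lintegral_swap]
    · refine setLIntegral_congr_fun measurableSet_Ioi fun z hz => ?_
      have h1 : ∀ s, ENNReal.ofReal (Real.exp (-b * z) * (z / s * g s z)) * kL (t - s)
          = ENNReal.ofReal (Real.exp (-b * z)) *
            (ENNReal.ofReal (z / s * g s z) * ENNReal.ofReal (1 / Real.sqrt (π * (t - s)))) := by
        intro s
        rw [ENNReal.ofReal_mul (Real.exp_pos _).le, mul_assoc]; rfl
      simp_rw [h1]
      rw [lintegral_const_mul' _ _ ENNReal.ofReal_ne_top, inner_sub ht hz, ← ENNReal.ofReal_mul (Real.exp_pos _).le]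
    · unfold kL g
      apply Measurable.aemeasurable
      simp only [Function.uncurry_def]
      fun_prop
  · rw [Set.indicator_of_notMem (by simpa using ht), Set.Ioo_eq_empty ht]
    simp

lemma k_eq {a : ℝ} (ha : 0 ≤ a) : kI = fun s => hI a s + ENNReal.ofReal a * eI a s := by
  funext s
  unfold kI hI eI
  by_cases hs : 0 < s
  · rw [Set.indicator_of_mem (by exact hs), Set.indicator_of_mem (by exact hs),
      Set.indicator_of_mem (by exact hs), hL_eq a hs, eL_eq a hs, ← ENNReal.ofReal_mul ha,
      ← ENNReal.ofReal_add (hf_nonneg a hs) (mul_nonneg ha (Ef_nonneg a s)), hf_eq hs]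
    unfold kL
    congr 1; ring
  · have : s ∉ Set.Ioi (0:ℝ) := hs
    simp [Set.indicator_of_notMem this]

lemma conv_lin (A B F : ℝ → ℝ≥0∞) (r : ℝ≥0∞) (hA : Measurable A) (hB : Measurable B) (hF : Measurable F) (t : ℝ) :
    lconvolution F (fun s => A s + r * B s) volume t
      = lconvolution F A volume t + r * lconvolution F B volume t := by
  simp only [lconvolution_def]
  rw [← lintegral_const_mul _ (by fun_prop), ← lintegral_add_left (by fun_prop)]
  refine lintegral_congr fun s => ?_
  ring

lemma conv_rel {a c : ℝ} (ha : 0 ≤ a) (hc : 0 ≤ c) (t : ℝ) :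
    ENNReal.ofReal c * eI c t + ENNReal.ofReal a * lconvolution (hI c) (hI a) volume t
      = ENNReal.ofReal a * eI a t + ENNReal.ofReal c * lconvolution (hI c) (hI a) volume t := by
  have h1 : eI c t = lconvolution (hI c) (hI a) volume t
      + ENNReal.ofReal a * lconvolution (hI c) (eI a) volume t := by
    rw [← conv_lin _ _ _ _ (hI_meas a) (eI_meas a) (hI_meas c), ← k_eq ha, h_conv_k]
  have h2 : eI a t = lconvolution (hI c) (hI a) volume t
      + ENNReal.ofReal c * lconvolution (hI a) (eI c) volume t := by
    rw [lconvolution_comm (f := hI c) (g := hI a),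
      ← conv_lin _ _ _ _ (hI_meas c) (eI_meas c) (hI_meas a), ← k_eq hc, h_conv_k]
  have h3 : lconvolution (hI c) (eI a) volume = lconvolution (hI a) (eI c) volume := by
    rw [← h_conv_k a, lconvolution_comm (f := hI a) (g := kI),
      lconvolution_assoc (hI_meas c) kI_meas (hI_meas a), h_conv_k, lconvolution_comm]
  rw [h1, h2, h3]
  ring

lemma hf_cont (b : ℝ) : ContinuousOn (hf b) (Set.Ioi 0) := by
  have h : ContinuousOn (fun s => 1 / Real.sqrt (π * s) - b * Ef b s) (Set.Ioi 0) := by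
    refine ContinuousOn.sub (ContinuousOn.div continuousOn_const (by fun_prop) ?_)
      (continuousOn_const.mul fun s hs => (Ef_deriv hs b).continuousAt.continuousWithinAt)
    intro s hs
    have hs : 0 < s := hs
    positivity
  exact h.congr fun s hs => hf_eq hs b

lemma conv_real {a c t : ℝ} (ha : 0 ≤ a) (hc : 0 ≤ c) (ht : 0 < t) :
    (a - c) * ∫ s in Set.Ioo 0 t, hf c s * hf a (t - s) = a * Ef a t - c * Ef c t := by
  have hP : lconvolution (hI c) (hI a) volume t
      = ∫⁻ s in Set.Ioo 0 t, ENNReal.ofReal (hf c s * hf a (t - s)) := by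
    unfold hI
    rw [conv_ind]
    refine setLIntegral_congr_fun measurableSet_Ioo fun s hs => ?_
    rw [hL_eq c hs.1, hL_eq a (sub_pos.2 hs.2), ENNReal.ofReal_mul (hf_nonneg c hs.1)]
  have hR : ∫ s in Set.Ioo 0 t, hf c s * hf a (t - s) = (lconvolution (hI c) (hI a) volume t).toReal := by
    rw [hP, integral_eq_lintegral_of_nonneg_ae]
    · filter_upwards [ae_restrict_mem measurableSet_Ioo] with s hs
      exact mul_nonneg (hf_nonneg c hs.1) (hf_nonneg a (sub_pos.2 hs.2))
    · refine ContinuousOn.aestronglyMeasurable ?_ measurableSet_Ioo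
      refine ((hf_cont c).mono fun s hs => hs.1).mul ((hf_cont a).comp (by fun_prop) ?_)
      intro s hs
      exact sub_pos.2 hs.2
  have hE : ∀ b, eI b t = ENNReal.ofReal (Ef b t) := fun b => by
    unfold eI
    rw [Set.indicator_of_mem (by exact ht), eL_eq b ht]
  have hfin : lconvolution (hI c) (hI a) volume t ≠ ⊤ := by
    have h1 : lconvolution (hI c) (hI a) volume t ≤ eI c t := by
      rw [← h_conv_k c, k_eq ha, conv_lin _ _ _ _ (hI_meas a) (eI_meas a) (hI_meas c)]
      exact le_self_add
    rw [hE] at h1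
    exact ne_top_of_le_ne_top ENNReal.ofReal_ne_top h1
  have hrel := congrArg ENNReal.toReal (conv_rel ha hc t)
  rw [hE, hE, ENNReal.toReal_add (by finiteness) (by finiteness), ENNReal.toReal_add (by finiteness) (by finiteness)] at hrel
  simp only [ENNReal.toReal_mul, ENNReal.toReal_ofReal ha, ENNReal.toReal_ofReal hc,
    ENNReal.toReal_ofReal (Ef_nonneg _ _)] at hrel
  rw [hR]
  linarith

/-- the tempered fractional boundary condition
`𝔇^{1/2,μ}_t u(t,0) + (c₀ + μ/2) u(t,0) = μ` for the positively drifted elastic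
Brownian motion, where the tempered Caputo derivative is written as the
convolution of the time derivative of `s ↦ u(s,0)` with the tail `Π̄_η`. -/
theorem stmt0 (μ c₀ : ℝ) (hμ : 0 ≤ μ) (hc : 0 ≤ c₀) (t : ℝ) (ht : 0 < t) :
    (∫ s in (0 : ℝ)..t, deriv (fun τ => uFun μ c₀ τ 0) s * PiBar (μ ^ 2 / 4) (t - s))
      + (c₀ + μ / 2) * uFun μ c₀ t 0 = μ := by
  have ha : 0 ≤ μ / 2 := by positivity
  have hsq : μ ^ 2 / 4 = (μ / 2) ^ 2 := by ring
  have h1 : (∫ s in (0 : ℝ)..t, deriv (fun τ => uFun μ c₀ τ 0) s * PiBar (μ ^ 2 / 4) (t - s))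
      = ∫ s in Set.Ioo 0 t, ((μ / 2 - c₀) * Real.exp (-(μ / 2) ^ 2 * t)) * (hf c₀ s * hf (μ / 2) (t - s)) := by
    rw [intervalIntegral.integral_of_le ht.le, integral_Ioc_eq_integral_Ioo]
    refine setIntegral_congr_fun measurableSet_Ioo fun s hs => ?_
    have he : Real.exp (-(μ / 2) ^ 2 * t)
        = Real.exp (-(μ / 2) ^ 2 * s) * Real.exp (-(μ / 2) ^ 2 * (t - s)) := by
      rw [← Real.exp_add]; congr 1; ring
    rw [u_deriv hμ hc hs.1, hsq, PiBar_eq ha (sub_pos.2 hs.2), he]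
    ring
  have h2 := conv_real ha hc ht
  have h3 := u_formula (μ := μ) hc ht
  rw [h1, integral_const_mul]
  linear_combination Real.exp (-(μ / 2) ^ 2 * t) * h2 + h3
end

section
/- Let μ ≥ 0, c₀ ≥ 0 and let u(t,x) = ∫₀^∞ m^μ(t,x,y) p⁰(t,x,y) dy. Then: (i) for all t > 0 and x > 0, ∂u/∂t (t,x) = μ ∂u/∂x (t,x) + ∂²u/∂x² (t,x); (ii) for every x > 0, u(t,x) → 1 as t → 0⁺; (iii) for every t > 0, the right derivative in x at x = 0 satisfies ∂u/∂x (t,0) = (c₀ − μ/2) · u(t,0). -/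
open MeasureTheory Real Filter

/-- normalized Gaussian distribution function. -/
noncomputable def Ph (r : ℝ) : ℝ := 1 / 2 + (∫ s in (0:ℝ)..r, Real.exp (-s ^ 2)) / Real.sqrt Real.pi

lemma Ph_hasDerivAt (r : ℝ) : HasDerivAt Ph (Real.exp (-r ^ 2) / Real.sqrt Real.pi) r := by
  have hc : Continuous (fun s : ℝ => Real.exp (-s ^ 2)) := by fun_prop
  have := intervalIntegral.integral_hasDerivAt_right (hc.intervalIntegrable 0 r)
    (hc.stronglyMeasurableAtFilter _ _) hc.continuousAt
  exact (this.div_const _).const_add _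

lemma gauss_int : Integrable (fun s : ℝ => Real.exp (-s ^ 2)) := by
  simpa using integrable_exp_neg_mul_sq (b := 1) one_pos

lemma Ph_top : Tendsto Ph atTop (nhds 1) := by
  have h := intervalIntegral_tendsto_integral_Ioi (μ := volume) (f := fun s : ℝ => Real.exp (-s ^ 2))
    0 gauss_int.integrableOn tendsto_id
  have h2 : ∫ s in Set.Ioi (0:ℝ), Real.exp (-s ^ 2) = Real.sqrt Real.pi / 2 := by
    simpa using integral_gaussian_Ioi 1
  rw [h2] at h
  have h3 := (h.div_const (Real.sqrt Real.pi)).const_add (1 / 2)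
  have : 1 / 2 + Real.sqrt Real.pi / 2 / Real.sqrt Real.pi = 1 := by
    have : Real.sqrt Real.pi ≠ 0 := by positivity
    field_simp; norm_num
  rw [this] at h3
  exact h3

lemma Ph_neg (r : ℝ) : Ph (-r) = 1 - Ph r := by
  have : ∫ s in (0:ℝ)..(-r), Real.exp (-s ^ 2) = - ∫ s in (0:ℝ)..r, Real.exp (-s ^ 2) := by
    have h := intervalIntegral.integral_comp_neg (a := 0) (b := r) (fun s : ℝ => Real.exp (-s ^ 2))
    simp only [neg_zero, neg_sq] at h
    rw [h, ← intervalIntegral.integral_symm]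
  unfold Ph
  rw [this]; ring

lemma Ph_bot : Tendsto Ph atBot (nhds 0) := by
  have h := (Ph_top.comp tendsto_neg_atBot_atTop).const_sub 1
  simp only [sub_self] at h
  refine h.congr fun r => ?_
  simp [Ph_neg]

/-- `A b t x = ∫₀^∞ e^{by} g(t,x+y) dy` in closed form. -/
noncomputable def A (b t x : ℝ) : ℝ :=
  Real.exp (-b * x + b ^ 2 * t) * Ph (b * Real.sqrt t - x / (2 * Real.sqrt t))

lemma key (b t x : ℝ) (ht : 0 < t) :
    Real.exp (-b * x + b ^ 2 * t) *
      (Real.exp (-(b * Real.sqrt t - x / (2 * Real.sqrt t)) ^ 2) / Real.sqrt Real.pi)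
      = 2 * Real.sqrt t * g t x := by
  have h4 : Real.sqrt (4 * Real.pi * t) = 2 * Real.sqrt Real.pi * Real.sqrt t := by
    rw [Real.sqrt_mul (by positivity), Real.sqrt_mul (by norm_num)]
    congr 2
    rw [show (4:ℝ) = 2 ^ 2 by norm_num, Real.sqrt_sq (by norm_num)]
  have hs : 0 < Real.sqrt t := Real.sqrt_pos.2 ht
  have hp : 0 < Real.sqrt Real.pi := Real.sqrt_pos.2 Real.pi_pos
  have hsq : Real.sqrt t ^ 2 = t := Real.sq_sqrt ht.le
  unfold g
  rw [h4, mul_div_assoc', ← Real.exp_add]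
  have : -b * x + b ^ 2 * t + -(b * Real.sqrt t - x / (2 * Real.sqrt t)) ^ 2 = -x ^ 2 / (4 * t) := by
    set s := Real.sqrt t
    rw [← hsq]
    field_simp
    ring
  rw [this]
  field_simp

lemma A_dx (b t x : ℝ) (ht : 0 < t) : HasDerivAt (A b t) (-b * A b t x - g t x) x := by
  have hs : 0 < Real.sqrt t := Real.sqrt_pos.2 ht
  have h1 : HasDerivAt (fun x : ℝ => -b * x + b ^ 2 * t) (-b) x := by
    simpa using ((hasDerivAt_id x).const_mul (-b)).add_const (b ^ 2 * t)
  have h2 : HasDerivAt (fun x : ℝ => b * Real.sqrt t - x / (2 * Real.sqrt t))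
      (-(1 / (2 * Real.sqrt t))) x := by
    simpa using ((hasDerivAt_id x).div_const (2 * Real.sqrt t)).const_sub (b * Real.sqrt t)
  have h := h1.exp.mul ((Ph_hasDerivAt _).comp x h2)
  have hk := key b t x ht
  refine h.congr_deriv ?_
  rw [← mul_assoc (Real.exp _) (_ / _) _, hk]
  simp only [A, Function.comp]
  field_simp
  ring

lemma A_dt (b t x : ℝ) (ht : 0 < t) :
    HasDerivAt (fun τ => A b τ x) (b ^ 2 * A b t x + (b + x / (2 * t)) * g t x) t := by
  have hs : 0 < Real.sqrt t := Real.sqrt_pos.2 ht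
  have hsq : Real.sqrt t ^ 2 = t := Real.sq_sqrt ht.le
  have h1 : HasDerivAt (fun τ : ℝ => -b * x + b ^ 2 * τ) (b ^ 2) t := by
    simpa using ((hasDerivAt_id t).const_mul (b ^ 2)).const_add (-b * x)
  have h0 := Real.hasDerivAt_sqrt ht.ne'
  have h2 : HasDerivAt (fun τ : ℝ => b * Real.sqrt τ - x / (2 * Real.sqrt τ))
      (b / (2 * Real.sqrt t) + x / (4 * t * Real.sqrt t)) t := by
    have := (h0.const_mul b).sub
      ((hasDerivAt_const t x).div (h0.const_mul 2) (by positivity))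
    refine this.congr_deriv ?_
    set s := Real.sqrt t
    rw [← hsq]
    field_simp
    ring
  have h := h1.exp.mul ((Ph_hasDerivAt _).comp t h2)
  have hk := key b t x ht
  refine h.congr_deriv ?_
  rw [← mul_assoc (Real.exp _) (_ / _) _, hk]
  simp only [A, Function.comp]
  field_simp
  ring

lemma g_dx (t x : ℝ) (ht : 0 < t) : HasDerivAt (g t) (-(x / (2 * t)) * g t x) x := by
  have h1 : HasDerivAt (fun x : ℝ => -x ^ 2 / (4 * t)) (-(x / (2 * t))) x := by
    have := (((hasDerivAt_id x).pow 2).neg).div_const (4 * t)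
    refine this.congr_deriv ?_
    simp
    field_simp
    ring
  have h := h1.exp.div_const (Real.sqrt (4 * Real.pi * t))
  refine h.congr_deriv ?_
  unfold g; ring

lemma g_pos (t x : ℝ) (ht : 0 < t) : 0 < g t x := by unfold g; positivity

lemma g_neg (t x : ℝ) : g t (-x) = g t x := by simp [g]

lemma A_decay (b t x : ℝ) (ht : 0 < t) :
    Tendsto (fun w => Real.exp (b * w) * A b t (x + w)) atTop (nhds 0) := by
  have hs : 0 < Real.sqrt t := Real.sqrt_pos.2 ht
  have h1 : Tendsto (fun w : ℝ => b * Real.sqrt t - (x + w) / (2 * Real.sqrt t)) atTop atBot := by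
    have : Tendsto (fun w : ℝ => (x + w) / (2 * Real.sqrt t)) atTop atTop :=
      (tendsto_atTop_add_const_left _ x tendsto_id).atTop_div_const (by positivity)
    have h2 := tendsto_atBot_add_const_left _ (b * Real.sqrt t) (tendsto_neg_atTop_atBot.comp this)
    refine h2.congr fun w => ?_
    simp [sub_eq_add_neg]
  have h := (Ph_bot.comp h1).const_mul (Real.exp (-b * x + b ^ 2 * t))
  rw [mul_zero] at h
  refine h.congr fun w => ?_
  simp only [A, Function.comp]
  rw [← mul_assoc, ← Real.exp_add]
  congr 2
  ring

lemma eA_dx (b d t x w : ℝ) (ht : 0 < t) :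
    HasDerivAt (fun w => Real.exp (d * w) * A b t (x + w))
      (Real.exp (d * w) * ((d - b) * A b t (x + w) - g t (x + w))) w := by
  have h1 : HasDerivAt (fun w : ℝ => d * w) d w := by
    simpa using (hasDerivAt_id w).const_mul d
  have h2 := (A_dx b t (x + w) ht).comp_const_add x w
  refine (h1.exp.mul h2).congr_deriv ?_
  ring

lemma A_int (b t x : ℝ) (ht : 0 < t) :
    IntegrableOn (fun w => Real.exp (b * w) * g t (x + w)) (Set.Ioi 0) ∧
    ∫ w in Set.Ioi (0:ℝ), Real.exp (b * w) * g t (x + w) = A b t x := by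
  have hd : ∀ w : ℝ, HasDerivAt (fun w => -(Real.exp (b * w) * A b t (x + w)))
      (Real.exp (b * w) * g t (x + w)) w := fun w =>
    (eA_dx b b t x w ht).neg.congr_deriv (by ring)
  have hl := (A_decay b t x ht).neg
  have hp : ∀ w ∈ Set.Ioi (0:ℝ), 0 ≤ Real.exp (b * w) * g t (x + w) := fun w _ =>
    (mul_pos (Real.exp_pos _) (g_pos t _ ht)).le
  refine ⟨integrableOn_Ioi_deriv_of_nonneg' (fun w _ => hd w) hp hl, ?_⟩
  rw [integral_Ioi_of_hasDerivAt_of_nonneg' (fun w _ => hd w) hp hl]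
  simp

lemma A_nonneg (b t x : ℝ) (ht : 0 < t) : 0 ≤ A b t x := by
  rw [← (A_int b t x ht).2]
  exact setIntegral_nonneg measurableSet_Ioi fun w _ =>
    (mul_pos (Real.exp_pos _) (g_pos t _ ht)).le

lemma A_mono (b d t x : ℝ) (ht : 0 < t) (h : b ≤ d) : A b t x ≤ A d t x := by
  rw [← (A_int b t x ht).2, ← (A_int d t x ht).2]
  refine setIntegral_mono_on (A_int b t x ht).1 (A_int d t x ht).1 measurableSet_Ioi fun w hw => ?_
  have hw : 0 < w := hw
  have := g_pos t (x + w) ht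
  gcongr

lemma g_decay (t x : ℝ) (ht : 0 < t) : Tendsto (fun w => g t (x + w)) atTop (nhds 0) := by
  have h1 : Tendsto (fun w : ℝ => (x + w) ^ 2 / (4 * t)) atTop atTop :=
    ((tendsto_pow_atTop two_ne_zero).comp
      (tendsto_atTop_add_const_left _ x tendsto_id)).atTop_div_const (by positivity)
  have h := (Real.tendsto_exp_neg_atTop_nhds_zero.comp h1).div_const (Real.sqrt (4 * Real.pi * t))
  rw [zero_div] at h
  refine h.congr fun w => ?_
  simp [g, neg_div]

lemma J_eq (c t s : ℝ) (hc : 0 ≤ c) (ht : 0 < t) (hs : 0 ≤ s) :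
    ∫ w in Set.Ioi (0 : ℝ), Real.exp (-c * w) * ((w + s) / t) * g t (w + s)
      = 2 * g t s - 2 * c * A (-c) t s := by
  have hd : ∀ w : ℝ, HasDerivAt (fun w => 2 * c * (Real.exp (-c * w) * A (-c) t (s + w))
      - 2 * (Real.exp (-c * w) * g t (s + w)))
      (Real.exp (-c * w) * ((w + s) / t) * g t (w + s)) w := fun w => by
    have h1 : HasDerivAt (fun w : ℝ => -c * w) (-c) w := by
      simpa using (hasDerivAt_id w).const_mul (-c)
    have h2 := (g_dx t (s + w) ht).comp_const_add s w
    refine (((eA_dx (-c) (-c) t s w ht).const_mul (2 * c)).sub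
      ((h1.exp.mul h2).const_mul 2)).congr_deriv ?_
    rw [add_comm w s]
    field_simp
    ring
  have hl1 := (A_decay (-c) t s ht).const_mul (2 * c)
  have hl2 : Tendsto (fun w => Real.exp (-c * w) * g t (s + w)) atTop (nhds 0) := by
    refine squeeze_zero' (Eventually.of_forall fun w =>
      (mul_pos (Real.exp_pos _) (g_pos t _ ht)).le) ?_ (g_decay t s ht)
    filter_upwards [eventually_ge_atTop 0] with w hw
    have : Real.exp (-c * w) ≤ 1 := Real.exp_le_one_iff.2 (by nlinarith)
    exact mul_le_of_le_one_left (g_pos t _ ht).le this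
  have hl := hl1.sub (hl2.const_mul 2)
  have hp : ∀ w ∈ Set.Ioi (0:ℝ), 0 ≤ Real.exp (-c * w) * ((w + s) / t) * g t (w + s) :=
    fun w hw => by
      have hw : 0 < w := hw
      have := g_pos t (w + s) ht
      positivity
  rw [integral_Ioi_of_hasDerivAt_of_nonneg' (fun w _ => hd w) hp hl]
  simp

lemma p0_eq (c t x y : ℝ) (hc : 0 ≤ c) (ht : 0 < t) (hx : 0 ≤ x) (hy : 0 ≤ y) :
    p0 c t x y = g t (-x + y) + g t (x + y) - 2 * c * A (-c) t (x + y) := by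
  unfold p0
  simp only [add_assoc]
  rw [J_eq c t (x + y) hc ht (by positivity), ← g_neg t (x - y),
    show -(x - y) = -x + y by ring]
  ring

lemma p0_nonneg (c t x y : ℝ) (ht : 0 < t) (hx : 0 ≤ x) (hy : 0 ≤ y) :
    0 ≤ p0 c t x y := by
  unfold p0
  have h1 : g t (x + y) ≤ g t (x - y) := by
    unfold g
    have : (x - y) ^ 2 ≤ (x + y) ^ 2 := by nlinarith [mul_nonneg hx hy]
    gcongr
  have h2 : 0 ≤ ∫ w in Set.Ioi (0 : ℝ), Real.exp (-c * w) * ((w + x + y) / t) * g t (w + x + y) :=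
    setIntegral_nonneg measurableSet_Ioi fun w hw => by
      have hw : 0 < w := hw
      have := g_pos t (w + x + y) ht
      positivity
  linarith

/-- closed form of `u` -/
noncomputable def U (a c t x : ℝ) : ℝ :=
  Real.exp (-a ^ 2 * t - a * x) *
    (A a t (-x) + A a t x - 2 * (c / (a + c)) * (A a t x - A (-c) t x))

lemma K_eq (a c : ℝ) (ha : 0 ≤ a) (hc : 0 ≤ c) : c / (a + c) * (a + c) = c := by
  rcases eq_or_ne (a + c) 0 with h | h
  · have : c = 0 := by linarith
    simp [this]
  · field_simp

lemma u_eq (μ c t x : ℝ) (hμ : 0 ≤ μ) (hc : 0 ≤ c) (ht : 0 < t) (hx : 0 ≤ x) :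
    uFun μ c t x = U (μ / 2) c t x := by
  unfold uFun
  obtain ⟨a, rfl⟩ : ∃ a, μ = 2 * a := ⟨μ / 2, by ring⟩
  have ha : 0 ≤ a := by linarith
  rw [show 2 * a / 2 = a by ring]
  have hK := K_eq a c ha hc
  unfold U
  set K := c / (a + c)
  have e1 : ∀ y, mKer (2 * a) t x y = Real.exp (-a ^ 2 * t - a * x) * Real.exp (a * y) := fun y => by
    unfold mKer; rw [← Real.exp_add]; congr 1; ring
  simp only [e1, mul_assoc]
  rw [integral_const_mul]
  congr 1
  have hd : ∀ y ∈ Set.Ici (0:ℝ), HasDerivAt (fun y => -(Real.exp (a * y) * A a t (-x + y))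
      - Real.exp (a * y) * A a t (x + y)
      + 2 * (K * (Real.exp (a * y) * A a t (x + y) - Real.exp (a * y) * A (-c) t (x + y))))
      (Real.exp (a * y) * p0 c t x y) y := fun y hy => by
    rw [p0_eq c t x y hc ht hx hy]
    have h1 := eA_dx a a t (-x) y ht
    have h2 := eA_dx a a t x y ht
    have h3 := eA_dx (-c) a t x y ht
    refine ((h1.neg.sub h2).add (((h2.sub h3).const_mul K).const_mul 2)).congr_deriv ?_
    linear_combination (-2) * Real.exp (a * y) * A (-c) t (x + y) * hK
  have l1 := A_decay a t (-x) ht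
  have l2 := A_decay a t x ht
  have l3 : Tendsto (fun w => Real.exp (a * w) * A (-c) t (x + w)) atTop (nhds 0) :=
    squeeze_zero (fun w => mul_nonneg (Real.exp_pos _).le (A_nonneg _ t _ ht))
      (fun w => mul_le_mul_of_nonneg_left (A_mono _ _ t _ ht (by linarith)) (Real.exp_pos _).le) l2
  have hl := (l1.neg.sub l2).add (((l2.sub l3).const_mul K).const_mul 2)
  have hp : ∀ y ∈ Set.Ioi (0:ℝ), 0 ≤ Real.exp (a * y) * p0 c t x y := fun y hy =>
    mul_nonneg (Real.exp_pos _).le (p0_nonneg c t x y ht hx (le_of_lt hy))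
  rw [integral_Ioi_of_hasDerivAt_of_nonneg' hd hp hl]
  simp
  ring

/-- the first `x` derivative of `U`. -/
noncomputable def Ux (a c t x : ℝ) : ℝ :=
  -a * U a c t x + Real.exp (-a ^ 2 * t - a * x) *
    (a * A a t (-x) + g t (-x) - a * A a t x - g t x
      - 2 * (c / (a + c)) * (-a * A a t x - c * A (-c) t x))

lemma exp_dx (a t x : ℝ) : HasDerivAt (fun x => Real.exp (-a ^ 2 * t - a * x))
    (Real.exp (-a ^ 2 * t - a * x) * (-a)) x := by
  have h1 : HasDerivAt (fun x : ℝ => -a ^ 2 * t - a * x) (-a) x := by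
    refine (((hasDerivAt_id x).const_mul a).const_sub (-a ^ 2 * t)).congr_deriv ?_
    ring
  exact h1.exp

lemma A_dx_neg (b t x : ℝ) (ht : 0 < t) :
    HasDerivAt (fun x => A b t (-x)) (b * A b t (-x) + g t (-x)) x :=
  ((A_dx b t (-x) ht).comp x (hasDerivAt_neg x)).congr_deriv (by ring)

lemma g_dx_neg (t x : ℝ) (ht : 0 < t) :
    HasDerivAt (fun x => g t (-x)) (-(x / (2 * t)) * g t x) x := by
  simp only [g_neg]; exact g_dx t x ht

lemma U_dx (a c t x : ℝ) (ht : 0 < t) : HasDerivAt (U a c t) (Ux a c t x) x := by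
  have h := (exp_dx a t x).mul (((A_dx_neg a t x ht).add (A_dx a t x ht)).sub
    (((A_dx a t x ht).sub (A_dx (-c) t x ht)).const_mul (2 * (c / (a + c)))))
  refine h.congr_deriv ?_
  simp only [Ux, U, Pi.add_apply, Pi.sub_apply]
  ring

lemma U_dxx (a c t x : ℝ) (ht : 0 < t) : HasDerivAt (Ux a c t)
    (-a * Ux a c t x + Real.exp (-a ^ 2 * t - a * x) * (-a) *
    (a * A a t (-x) + g t (-x) - a * A a t x - g t x
      - 2 * (c / (a + c)) * (-a * A a t x - c * A (-c) t x))
    + Real.exp (-a ^ 2 * t - a * x) *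
     (a * (a * A a t (-x) + g t (-x)) + (-(x / (2 * t)) * g t x) - a * (-a * A a t x - g t x)
      - (-(x / (2 * t)) * g t x)
      - 2 * (c / (a + c)) * (-a * (-a * A a t x - g t x) - c * (-(-c) * A (-c) t x - g t x)))) x := by
  have h := ((U_dx a c t x ht).const_mul (-a)).add ((exp_dx a t x).mul
    ((((((A_dx_neg a t x ht).const_mul a).add (g_dx_neg t x ht)).sub
      ((A_dx a t x ht).const_mul a)).sub (g_dx t x ht)).sub
      ((((A_dx a t x ht).const_mul (-a)).sub ((A_dx (-c) t x ht).const_mul c)).const_mul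
        (2 * (c / (a + c))))))
  refine h.congr_deriv ?_
  simp only [Pi.add_apply, Pi.sub_apply]
  ring

lemma U_dt (a c t x : ℝ) (ht : 0 < t) : HasDerivAt (fun τ => U a c τ x)
    (-a ^ 2 * U a c t x + Real.exp (-a ^ 2 * t - a * x) *
     ((a ^ 2 * A a t (-x) + (a + (-x) / (2 * t)) * g t (-x))
      + (a ^ 2 * A a t x + (a + x / (2 * t)) * g t x)
      - 2 * (c / (a + c)) * ((a ^ 2 * A a t x + (a + x / (2 * t)) * g t x)
        - ((-c) ^ 2 * A (-c) t x + (-c + x / (2 * t)) * g t x)))) t := by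
  have h1 : HasDerivAt (fun τ : ℝ => -a ^ 2 * τ - a * x) (-a ^ 2) t := by
    simpa using ((hasDerivAt_id t).const_mul (-a ^ 2)).sub_const (a * x)
  have h := h1.exp.mul (((A_dt a t (-x) ht).add (A_dt a t x ht)).sub
    (((A_dt a t x ht).sub (A_dt (-c) t x ht)).const_mul (2 * (c / (a + c)))))
  refine h.congr_deriv ?_
  simp only [U, Pi.add_apply, Pi.sub_apply]
  ring

lemma arg_lim (x : ℝ) (hx : 0 < x) :
    Tendsto (fun t : ℝ => x / (2 * Real.sqrt t)) (nhdsWithin 0 (Set.Ioi 0)) atTop := by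
  have h1 : Tendsto (fun t : ℝ => 2 * Real.sqrt t) (nhdsWithin 0 (Set.Ioi 0))
      (nhdsWithin 0 (Set.Ioi 0)) := by
    refine tendsto_nhdsWithin_iff.2 ⟨?_, ?_⟩
    · have : Tendsto (fun t : ℝ => 2 * Real.sqrt t) (nhds 0) (nhds (2 * Real.sqrt 0)) :=
        Continuous.tendsto (by fun_prop) 0
      rw [Real.sqrt_zero, mul_zero] at this
      exact this.mono_left nhdsWithin_le_nhds
    · filter_upwards [self_mem_nhdsWithin] with t ht
      have := Real.sqrt_pos.2 ht
      exact mul_pos two_pos this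
  exact (tendsto_inv_nhdsGT_zero.comp h1).const_mul_atTop hx

lemma sqrt_lim (b : ℝ) : Tendsto (fun t : ℝ => b * Real.sqrt t) (nhdsWithin 0 (Set.Ioi 0))
    (nhds 0) := by
  have : Tendsto (fun t : ℝ => b * Real.sqrt t) (nhds 0) (nhds (b * Real.sqrt 0)) :=
    Continuous.tendsto (by fun_prop) 0
  rw [Real.sqrt_zero, mul_zero] at this
  exact this.mono_left nhdsWithin_le_nhds

lemma exp_lim (b x : ℝ) : Tendsto (fun t : ℝ => Real.exp (-b * x + b ^ 2 * t))
    (nhdsWithin 0 (Set.Ioi 0)) (nhds (Real.exp (-b * x))) := by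
  have : Tendsto (fun t : ℝ => Real.exp (-b * x + b ^ 2 * t)) (nhds 0)
      (nhds (Real.exp (-b * x + b ^ 2 * 0))) := Continuous.tendsto (by fun_prop) 0
  rw [mul_zero, add_zero] at this
  exact this.mono_left nhdsWithin_le_nhds

lemma A_lim_pos (b x : ℝ) (hx : 0 < x) :
    Tendsto (fun t => A b t (-x)) (nhdsWithin 0 (Set.Ioi 0)) (nhds (Real.exp (b * x))) := by
  have h := (exp_lim b (-x)).mul (Ph_top.comp ((sqrt_lim b).add_atTop (arg_lim x hx)))
  rw [mul_one, neg_mul_neg] at h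
  refine h.congr fun t => ?_
  simp only [A, Function.comp]
  rw [neg_mul_neg, neg_div, sub_neg_eq_add]

lemma A_lim_neg (b x : ℝ) (hx : 0 < x) :
    Tendsto (fun t => A b t x) (nhdsWithin 0 (Set.Ioi 0)) (nhds 0) := by
  have h := (exp_lim b x).mul (Ph_bot.comp ((sqrt_lim b).add_atBot
    (tendsto_neg_atTop_atBot.comp (arg_lim x hx))))
  rw [mul_zero] at h
  refine h.congr fun t => ?_
  simp only [A, Function.comp]
  congr 2

/-- `u` solves the drifted heat equation on `(0,∞)×(0,∞)`, attains the
initial datum `1` as `t → 0⁺`, and satisfies the elastic (Robin) boundary condition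
`∂u/∂x(t,0) = (c₀ - μ/2) u(t,0)` (right derivative at `x = 0`). -/
theorem stmt1 (μ c₀ : ℝ) (hμ : 0 ≤ μ) (hc : 0 ≤ c₀) :
    (∀ t > (0 : ℝ), ∀ x > (0 : ℝ),
      deriv (fun τ => uFun μ c₀ τ x) t =
        μ * deriv (fun ξ => uFun μ c₀ t ξ) x + deriv (deriv (fun ξ => uFun μ c₀ t ξ)) x) ∧
    (∀ x > (0 : ℝ),
      Filter.Tendsto (fun t => uFun μ c₀ t x) (nhdsWithin 0 (Set.Ioi 0)) (nhds 1)) ∧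
    (∀ t > (0 : ℝ),
      derivWithin (fun ξ => uFun μ c₀ t ξ) (Set.Ici 0) 0 = (c₀ - μ / 2) * uFun μ c₀ t 0) := by
  refine ⟨fun t ht x hx => ?_, fun x hx => ?_, fun t ht => ?_⟩
  · have e1 : (fun τ => uFun μ c₀ τ x) =ᶠ[nhds t] fun τ => U (μ / 2) c₀ τ x := by
      filter_upwards [lt_mem_nhds ht] with τ hτ
      exact u_eq μ c₀ τ x hμ hc hτ hx.le
    have e2 : (fun ξ => uFun μ c₀ t ξ) =ᶠ[nhds x] U (μ / 2) c₀ t := by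
      filter_upwards [lt_mem_nhds hx] with ξ hξ
      exact u_eq μ c₀ t ξ hμ hc ht hξ.le
    have e3 : deriv (U (μ / 2) c₀ t) = Ux (μ / 2) c₀ t := funext fun z => (U_dx _ _ t z ht).deriv
    rw [e1.deriv_eq, e2.deriv_eq, e2.deriv.deriv_eq, e3, (U_dt _ _ t x ht).deriv,
      (U_dxx _ _ t x ht).deriv]
    simp only [Ux, g_neg]
    ring
  · have e1 : (fun t => U (μ / 2) c₀ t x) =ᶠ[nhdsWithin 0 (Set.Ioi 0)] fun t => uFun μ c₀ t x := by
      filter_upwards [self_mem_nhdsWithin] with τ hτ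
      exact (u_eq μ c₀ τ x hμ hc hτ hx.le).symm
    refine Tendsto.congr' e1 ?_
    have h0 : Tendsto (fun t : ℝ => Real.exp (-(μ / 2) ^ 2 * t - μ / 2 * x))
        (nhdsWithin 0 (Set.Ioi 0)) (nhds (Real.exp (-(μ / 2) ^ 2 * 0 - μ / 2 * x))) :=
      (Continuous.tendsto (by fun_prop) 0).mono_left nhdsWithin_le_nhds
    have h := h0.mul (((A_lim_pos (μ / 2) x hx).add (A_lim_neg (μ / 2) x hx)).sub
      (((A_lim_neg (μ / 2) x hx).sub (A_lim_neg (-c₀) x hx)).const_mul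
        (2 * (c₀ / (μ / 2 + c₀)))))
    have e : Real.exp (-(μ / 2) ^ 2 * 0 - μ / 2 * x) * (Real.exp (μ / 2 * x) + 0
        - 2 * (c₀ / (μ / 2 + c₀)) * (0 - 0)) = 1 := by
      rw [sub_self, mul_zero, mul_zero, sub_zero, add_zero, ← Real.exp_add]
      simp
    rw [e] at h
    exact h
  · have e2 : Set.EqOn (fun ξ => uFun μ c₀ t ξ) (U (μ / 2) c₀ t) (Set.Ici 0) := fun ξ hξ =>
      u_eq μ c₀ t ξ hμ hc ht hξ
    have h0 : (0:ℝ) ∈ Set.Ici (0:ℝ) := Set.self_mem_Ici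
    rw [derivWithin_congr e2 (e2 h0),
      (U_dx _ _ t 0 ht).hasDerivWithinAt.derivWithin (uniqueDiffOn_Ici 0 0 h0),
      u_eq μ c₀ t 0 hμ hc ht le_rfl]
    have hK := K_eq (μ / 2) c₀ (by linarith) hc
    simp only [Ux, U, neg_zero]
    set K := c₀ / (μ / 2 + c₀)
    linear_combination (2 * Real.exp (-(μ / 2) ^ 2 * t - μ / 2 * 0) * A (μ / 2) t 0) * hK
end

section
/- Let μ ≥ 0, c₀ ≥ 0 and let u₋(t,x) = ∫₀^∞ m^{−μ}(t,x,y) p⁰(t,x,y) dy. Then for every λ > 0 and x ≥ 0, ∫₀^∞ e^{−λt} u₋(t,x) dt = 1/λ − (1/λ) · (1 − Φ(λ)/(c₀ + μ/2 + Φ(λ))) · e^{−x Φ(λ)}, where Φ(λ) = √(λ + μ²/4) − μ/2. -/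
open MeasureTheory Real Filter

/-- `u₋(t,x) = ∫₀^∞ m^{-μ}(t,x,y) p⁰(t,x,y) dy`, the negatively drifted case. -/
noncomputable def uNeg (μ c₀ t x : ℝ) : ℝ :=
  ∫ y in Set.Ioi (0 : ℝ), mKer (-μ) t x y * p0 c₀ t x y


lemma exists_erf : ∃ E : ℝ → ℝ, (∀ v, HasDerivAt E (Real.exp (-v ^ 2)) v) ∧
    Tendsto E atBot (nhds 0) ∧ Tendsto E atTop (nhds (√π)) := by
  have hc : Continuous fun r : ℝ => Real.exp (-r ^ 2) := by fun_prop
  have hi : Integrable fun r : ℝ => Real.exp (-r ^ 2) := by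
    simpa using integrable_exp_neg_mul_sq (b := 1) one_pos
  have h1 : Tendsto (fun v : ℝ => ∫ r in (0 : ℝ)..v, Real.exp (-r ^ 2)) atTop (nhds (√π / 2)) := by
    have := intervalIntegral_tendsto_integral_Ioi 0 hi.integrableOn tendsto_id
    have h2 := integral_gaussian_Ioi 1
    simp only [neg_mul, one_mul, div_one] at h2
    rw [h2] at this
    exact this
  refine ⟨fun v => √π / 2 + ∫ r in (0 : ℝ)..v, Real.exp (-r ^ 2), ?_, ?_, ?_⟩
  · intro v
    exact (intervalIntegral.integral_hasDerivAt_right (hc.intervalIntegrable _ _)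
      (hc.stronglyMeasurableAtFilter _ _) hc.continuousAt).const_add _
  · have h3 := (h1.comp tendsto_neg_atBot_atTop).const_sub (√π / 2)
    rw [sub_self] at h3
    refine h3.congr fun v => ?_
    have := intervalIntegral.integral_comp_neg (a := 0) (b := v) (fun r : ℝ => Real.exp (-r ^ 2))
    simp only [even_two, Even.neg_pow, neg_zero] at this
    rw [this, intervalIntegral.integral_symm]
    simp only [Function.comp]
    ring
  · have := h1.const_add (√π / 2)
    rwa [add_halves] at this

/-- generic improper FTC on the open half line -/
lemma ftc_open (F f : ℝ → ℝ) (L : ℝ) (h : ∀ t ∈ Set.Ioi (0:ℝ), HasDerivAt F (f t) t)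
    (hf : ∀ t ∈ Set.Ioi (0:ℝ), 0 ≤ f t)
    (h0 : Tendsto F (nhdsWithin 0 (Set.Ioi 0)) (nhds 0)) (h1 : Tendsto F atTop (nhds L)) :
    IntegrableOn f (Set.Ioi 0) ∧ ∫ t in Set.Ioi (0:ℝ), f t = L := by
  have hG : ∀ t ∈ Set.Ioi (0:ℝ), HasDerivAt (Function.update F 0 0) (f t) t := by
    intro t ht
    refine (h t ht).congr_of_eventuallyEq ?_
    filter_upwards [eventually_ne_nhds (ne_of_gt ht)] with u hu
    simp [Function.update_of_ne hu]
  have hc : ContinuousWithinAt (Function.update F 0 0) (Set.Ici 0) 0 := by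
    rw [continuousWithinAt_update_same]
    simpa using h0
  have hl : Tendsto (Function.update F 0 0) atTop (nhds L) := by
    refine h1.congr' ?_
    filter_upwards [eventually_ne_atTop 0] with u hu
    simp [Function.update_of_ne hu]
  refine ⟨integrableOn_Ioi_deriv_of_nonneg hc hG hf hl, ?_⟩
  rw [integral_Ioi_of_hasDerivAt_of_nonneg hc hG hf hl]
  simp

lemma kernel_core (s z : ℝ) (hs : 0 < s) (hz : 0 < z) (σ : ℝ) (hσ : σ = 1 ∨ σ = -1) :
    let f := fun t : ℝ => ((1 + σ) * (z / (4 * t * √t)) + (1 - σ) * (s / (2 * √t))) *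
      Real.exp (-s ^ 2 * t - z ^ 2 / (4 * t))
    IntegrableOn f (Set.Ioi 0) ∧ ∫ t in Set.Ioi (0:ℝ), f t = Real.exp (-s * z) * √π := by
  intro f
  obtain ⟨E, hE, hb, ht⟩ := exists_erf
  have hsq0 : Tendsto (fun t : ℝ => √t) (nhdsWithin 0 (Set.Ioi 0)) (nhdsWithin 0 (Set.Ioi 0)) := by
    refine tendsto_nhdsWithin_iff.2 ⟨?_, ?_⟩
    · have := Real.continuous_sqrt.tendsto 0
      rw [Real.sqrt_zero] at this
      exact this.mono_left nhdsWithin_le_nhds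
    · filter_upwards [self_mem_nhdsWithin] with t ht using Real.sqrt_pos.2 ht
  have hinv0 : Tendsto (fun t : ℝ => z / 2 * (√t)⁻¹) (nhdsWithin 0 (Set.Ioi 0)) atTop :=
    (tendsto_inv_nhdsGT_zero.comp hsq0).const_mul_atTop (by positivity)
  have hinv1 : Tendsto (fun t : ℝ => z / 2 * (√t)⁻¹) atTop (nhds 0) := by
    have := (tendsto_inv_atTop_zero.comp Real.tendsto_sqrt_atTop).const_mul (z / 2)
    simpa using this
  have hs0 : Tendsto (fun t : ℝ => s * √t) (nhdsWithin 0 (Set.Ioi 0)) (nhds 0) := by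
    have := (tendsto_nhdsWithin_iff.1 hsq0).1.const_mul s
    simpa using this
  have hs1 : Tendsto (fun t : ℝ => s * √t) atTop atTop :=
    Real.tendsto_sqrt_atTop.const_mul_atTop hs
  refine ftc_open (fun t => Real.exp (-s * z) * E (s * √t - z / 2 * (√t)⁻¹)
    + σ * (Real.exp (s * z) * E (-(s * √t) - z / 2 * (√t)⁻¹))) f _ ?_ ?_ ?_ ?_
  · intro t ht
    have ht : 0 < t := ht
    have hr : 0 < √t := Real.sqrt_pos.2 ht
    have d1 : HasDerivAt (fun t : ℝ => s * √t) (s * (1 / (2 * √t))) t :=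
      (Real.hasDerivAt_sqrt ht.ne').const_mul s
    have d2 : HasDerivAt (fun t : ℝ => z / 2 * (√t)⁻¹)
        (z / 2 * (-(1 / (2 * √t)) / (√t) ^ 2)) t :=
      ((Real.hasDerivAt_sqrt ht.ne').inv hr.ne').const_mul _
    have e1 := ((hE _).comp t (d1.sub d2)).const_mul (Real.exp (-s * z))
    have e2 := (((hE _).comp t (d1.neg.sub d2)).const_mul (Real.exp (s * z))).const_mul σ
    refine (e1.add e2).congr_deriv ?_
    have hq : √t ^ 2 = t := Real.sq_sqrt ht.le
    have x1 : Real.exp (-s * z) * Real.exp (-(s * √t - z / 2 * (√t)⁻¹) ^ 2)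
        = Real.exp (-s ^ 2 * t - z ^ 2 / (4 * t)) := by
      rw [← Real.exp_add]; congr 1
      generalize √t = r at *
      subst hq; field_simp; ring
    have x2 : Real.exp (s * z) * Real.exp (-(-(s * √t) - z / 2 * (√t)⁻¹) ^ 2)
        = Real.exp (-s ^ 2 * t - z ^ 2 / (4 * t)) := by
      rw [← Real.exp_add]; congr 1
      generalize √t = r at *
      subst hq; field_simp; ring
    simp only [Pi.sub_apply, Pi.neg_apply, f]
    rw [← mul_assoc, ← mul_assoc (Real.exp (s * z)), x1, x2]
    generalize Real.exp (-s ^ 2 * t - z ^ 2 / (4 * t)) = e at *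
    clear x1 x2 d1 d2 e1 e2
    generalize √t = r at *
    subst hq; field_simp; ring
  · intro t ht
    have ht : 0 < t := ht
    rcases hσ with rfl | rfl <;> simp only [f] <;> norm_num <;> positivity
  · have a1 : Tendsto (fun t : ℝ => s * √t - z / 2 * (√t)⁻¹) (nhdsWithin 0 (Set.Ioi 0)) atBot := by
      simp only [sub_eq_add_neg]
      exact hs0.add_atBot (tendsto_neg_atTop_atBot.comp hinv0)
    have a2 : Tendsto (fun t : ℝ => -(s * √t) - z / 2 * (√t)⁻¹) (nhdsWithin 0 (Set.Ioi 0)) atBot := by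
      simp only [sub_eq_add_neg]
      exact hs0.neg.add_atBot (tendsto_neg_atTop_atBot.comp hinv0)
    have := ((hb.comp a1).const_mul (Real.exp (-s * z))).add
      (((hb.comp a2).const_mul (Real.exp (s * z))).const_mul σ)
    simpa using this
  · have a1 : Tendsto (fun t : ℝ => s * √t - z / 2 * (√t)⁻¹) atTop atTop := by
      simp only [sub_eq_add_neg]
      exact hs1.atTop_add hinv1.neg
    have a2 : Tendsto (fun t : ℝ => -(s * √t) - z / 2 * (√t)⁻¹) atTop atBot := by
      simp only [sub_eq_add_neg]
      exact (tendsto_neg_atTop_atBot.comp hs1).atBot_add hinv1.neg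
    have := ((ht.comp a1).const_mul (Real.exp (-s * z))).add
      (((hb.comp a2).const_mul (Real.exp (s * z))).const_mul σ)
    simpa using this

lemma g_eq (t z : ℝ) (ht : 0 < t) : g t z = Real.exp (-z ^ 2 / (4 * t)) / (2 * √π * √t) := by
  unfold g
  congr 1
  rw [show 4 * π * t = 2 ^ 2 * π * t by ring, Real.sqrt_mul (by positivity),
    Real.sqrt_mul (by positivity), Real.sqrt_sq (by norm_num)]

lemma gInt (s z : ℝ) (hs : 0 < s) (hz : z ≠ 0) :
    IntegrableOn (fun t => Real.exp (-s ^ 2 * t) * g t z) (Set.Ioi 0) ∧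
    ∫ t in Set.Ioi (0:ℝ), Real.exp (-s ^ 2 * t) * g t z = Real.exp (-s * |z|) / (2 * s) := by
  obtain ⟨h1, h2⟩ := kernel_core s |z| hs (abs_pos.2 hz) (-1) (Or.inr rfl)
  have hp : 0 < √π := Real.sqrt_pos.2 Real.pi_pos
  have key : Set.EqOn (fun t : ℝ => 1 / (2 * s * √π) * (((1 + -1) * (|z| / (4 * t * √t)) + (1 - -1) * (s / (2 * √t))) *
      Real.exp (-s ^ 2 * t - |z| ^ 2 / (4 * t)))) (fun t => Real.exp (-s ^ 2 * t) * g t z)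
      (Set.Ioi 0) := by
    intro t ht
    have ht : 0 < t := ht
    have hr : 0 < √t := Real.sqrt_pos.2 ht
    simp only
    rw [g_eq t z ht, sq_abs, sub_eq_add_neg (-s ^ 2 * t), Real.exp_add, neg_div]
    field_simp
    ring
  refine ⟨IntegrableOn.congr_fun (h1.const_mul (1 / (2 * s * √π))) key measurableSet_Ioi, ?_⟩
  rw [← setIntegral_congr_fun measurableSet_Ioi key, integral_const_mul, h2]
  field_simp

lemma hInt (s z : ℝ) (hs : 0 < s) (hz : 0 < z) :
    IntegrableOn (fun t => Real.exp (-s ^ 2 * t) * (z / t * g t z)) (Set.Ioi 0) ∧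
    ∫ t in Set.Ioi (0:ℝ), Real.exp (-s ^ 2 * t) * (z / t * g t z) = Real.exp (-s * z) := by
  obtain ⟨h1, h2⟩ := kernel_core s z hs hz 1 (Or.inl rfl)
  have hp : 0 < √π := Real.sqrt_pos.2 Real.pi_pos
  have key : Set.EqOn (fun t : ℝ => 1 / √π * (((1 + 1) * (z / (4 * t * √t)) + (1 - 1) * (s / (2 * √t))) *
      Real.exp (-s ^ 2 * t - z ^ 2 / (4 * t)))) (fun t => Real.exp (-s ^ 2 * t) * (z / t * g t z))
      (Set.Ioi 0) := by
    intro t ht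
    have ht : 0 < t := ht
    have hr : 0 < √t := Real.sqrt_pos.2 ht
    simp only
    rw [g_eq t z ht, sub_eq_add_neg (-s ^ 2 * t), Real.exp_add, neg_div]
    field_simp
    ring
  refine ⟨IntegrableOn.congr_fun (h1.const_mul (1 / √π)) key measurableSet_Ioi, ?_⟩
  rw [← setIntegral_congr_fun measurableSet_Ioi key, integral_const_mul, h2]
  field_simp

/-- Tonelli swap with known inner integral. -/
lemma swap (f : ℝ → ℝ → ℝ) (F : ℝ → ℝ) (hm : Measurable (Function.uncurry f))
    (hn : ∀ y ∈ Set.Ioi (0:ℝ), ∀ t ∈ Set.Ioi (0:ℝ), 0 ≤ f y t)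
    (h : ∀ᵐ y ∂(volume.restrict (Set.Ioi (0:ℝ))), IntegrableOn (f y) (Set.Ioi 0) ∧
      ∫ t in Set.Ioi (0:ℝ), f y t = F y)
    (hF : IntegrableOn F (Set.Ioi 0)) :
    IntegrableOn (fun t => ∫ y in Set.Ioi (0:ℝ), f y t) (Set.Ioi 0) ∧
    (∫ t in Set.Ioi (0:ℝ), ∫ y in Set.Ioi (0:ℝ), f y t = ∫ y in Set.Ioi (0:ℝ), F y) ∧
    ∀ᵐ t ∂(volume.restrict (Set.Ioi (0:ℝ))), IntegrableOn (fun y => f y t) (Set.Ioi 0) := by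
  have hI : Integrable (Function.uncurry f)
      ((volume.restrict (Set.Ioi (0:ℝ))).prod (volume.restrict (Set.Ioi (0:ℝ)))) := by
    rw [integrable_prod_iff hm.aestronglyMeasurable]
    refine ⟨h.mono fun y hy => hy.1, hF.congr ?_⟩
    filter_upwards [h, ae_restrict_mem measurableSet_Ioi] with y hy hy0
    rw [← hy.2]
    refine setIntegral_congr_fun measurableSet_Ioi fun t ht => ?_
    simp [Function.uncurry, abs_of_nonneg (hn y hy0 t ht)]
  refine ⟨hI.integral_prod_right, ?_, hI.prod_left_ae⟩
  rw [← integral_integral_swap hI]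
  exact integral_congr_ae (h.mono fun y hy => hy.2)

lemma g_meas : Measurable (Function.uncurry g) := by
  unfold g Function.uncurry
  fun_prop

lemma g_meas' {α : Type*} [MeasurableSpace α] (u v : α → ℝ) (hu : Measurable u)
    (hv : Measurable v) : Measurable fun p => g (u p) (v p) :=
  g_meas.comp (hu.prodMk hv)

lemma FB_int (a s x k : ℝ) (h : 0 < a + s) :
    IntegrableOn (fun y => Real.exp (a * (x - y)) * (Real.exp (-s * (x + y)) / k)) (Set.Ioi 0) ∧
    ∫ y in Set.Ioi (0:ℝ), Real.exp (a * (x - y)) * (Real.exp (-s * (x + y)) / k)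
      = Real.exp (-x * (s - a)) / k / (s + a) := by
  have e : (fun y => Real.exp (a * (x - y)) * (Real.exp (-s * (x + y)) / k))
      = fun y => Real.exp (-x * (s - a)) / k * Real.exp (-(a + s) * y) := by
    funext y
    rw [mul_div_assoc', div_mul_eq_mul_div, ← Real.exp_add, ← Real.exp_add]
    ring_nf
  have hn : -(a + s) < 0 := by linarith
  rw [e]
  refine ⟨(integrableOn_exp_mul_Ioi hn 0).const_mul _, ?_⟩
  rw [integral_const_mul, integral_exp_mul_Ioi hn]
  have : s + a ≠ 0 := by linarith
  rw [neg_div_neg_eq]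
  simp [add_comm a s, div_eq_mul_inv]

lemma FA_int (a s x : ℝ) (hs : 0 < s) (hx : 0 ≤ x) (h : 0 < a + s) (h' : 0 < s - a) :
    IntegrableOn (fun y => Real.exp (a * (x - y)) * (Real.exp (-s * |x - y|) / (2 * s)))
      (Set.Ioi 0) ∧
    ∫ y in Set.Ioi (0:ℝ), Real.exp (a * (x - y)) * (Real.exp (-s * |x - y|) / (2 * s))
      = (1 / (s + a) + (1 - Real.exp (-x * (s - a))) / (s - a)) / (2 * s) := by
  have hn : -(a + s) < 0 := by linarith
  have e1 : Set.EqOn (fun y => Real.exp ((a + s) * x) / (2 * s) * Real.exp (-(a + s) * y))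
      (fun y => Real.exp (a * (x - y)) * (Real.exp (-s * |x - y|) / (2 * s))) (Set.Ioi x) := by
    intro y hy
    have hy : x < y := hy
    simp only
    rw [abs_of_neg (by linarith), mul_div_assoc', div_mul_eq_mul_div, ← Real.exp_add,
      ← Real.exp_add]
    ring_nf
  have e2 : Set.EqOn (fun y => Real.exp (-x * (s - a)) / (2 * s) * Real.exp ((s - a) * y))
      (fun y => Real.exp (a * (x - y)) * (Real.exp (-s * |x - y|) / (2 * s))) (Set.Ioc 0 x) := by
    intro y hy
    have hy : y ≤ x := hy.2
    simp only
    rw [abs_of_nonneg (by linarith), mul_div_assoc', div_mul_eq_mul_div, ← Real.exp_add,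
      ← Real.exp_add]
    ring_nf
  have i1 := IntegrableOn.congr_fun ((integrableOn_exp_mul_Ioi hn x).const_mul
    (Real.exp ((a + s) * x) / (2 * s))) e1 measurableSet_Ioi
  have hc : Continuous fun y => Real.exp (-x * (s - a)) / (2 * s) * Real.exp ((s - a) * y) := by
    fun_prop
  have i2 := IntegrableOn.congr_fun
    ((hc.integrableOn_Icc (μ := volume) (a := 0) (b := x)).mono_set Set.Ioc_subset_Icc_self) e2 measurableSet_Ioc
  rw [← Set.Ioc_union_Ioi_eq_Ioi hx]
  refine ⟨i2.union i1, ?_⟩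
  rw [setIntegral_union (Set.Ioc_disjoint_Ioi le_rfl) measurableSet_Ioi i2 i1,
    ← setIntegral_congr_fun measurableSet_Ioi e1, ← setIntegral_congr_fun measurableSet_Ioc e2,
    integral_const_mul, integral_const_mul, integral_exp_mul_Ioi hn,
    ← intervalIntegral.integral_of_le hx]
  have e3 : ∫ y in (0:ℝ)..x, Real.exp ((s - a) * y) = (Real.exp ((s - a) * x) - 1) / (s - a) := by
    rw [intervalIntegral.integral_comp_mul_left (fun y => Real.exp y) h'.ne', integral_exp]
    simp [div_eq_inv_mul]
  rw [e3, neg_div_neg_eq]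
  have x1 : Real.exp ((a + s) * x) * Real.exp (-(a + s) * x) = 1 := by
    rw [← Real.exp_add, show (a + s) * x + -(a + s) * x = 0 by ring, Real.exp_zero]
  have x2 : Real.exp (-x * (s - a)) * Real.exp ((s - a) * x) = 1 := by
    rw [← Real.exp_add]; ring_nf; simp
  have n1 : a + s ≠ 0 := h.ne'
  rw [add_comm s a]
  calc _ = (Real.exp (-x * (s - a)) * Real.exp ((s - a) * x) - Real.exp (-x * (s - a)))
        / (s - a) / (2 * s) + (Real.exp ((a + s) * x) * Real.exp (-(a + s) * x)) / (a + s) / (2 * s) := by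
        ring
    _ = _ := by rw [x1, x2]; ring

lemma C_inner (s c₀ x y : ℝ) (hs : 0 < s) (hc : 0 ≤ c₀) (hx : 0 ≤ x) (hy : 0 < y) :
    IntegrableOn (fun t => ∫ w in Set.Ioi (0:ℝ), Real.exp (-c₀ * w) *
      (Real.exp (-s ^ 2 * t) * ((w + x + y) / t * g t (w + x + y)))) (Set.Ioi 0) ∧
    ∫ t in Set.Ioi (0:ℝ), ∫ w in Set.Ioi (0:ℝ), Real.exp (-c₀ * w) *
      (Real.exp (-s ^ 2 * t) * ((w + x + y) / t * g t (w + x + y)))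
      = Real.exp (-s * (x + y)) / (c₀ + s) := by
  have hn : -(c₀ + s) < 0 := by linarith
  have eF : (fun w => Real.exp (-c₀ * w) * Real.exp (-s * (w + x + y)))
      = fun w => Real.exp (-s * (x + y)) * Real.exp (-(c₀ + s) * w) := by
    funext w
    rw [← Real.exp_add, ← Real.exp_add]; ring_nf
  obtain ⟨h1, h2, -⟩ := swap (fun w t => Real.exp (-c₀ * w) *
      (Real.exp (-s ^ 2 * t) * ((w + x + y) / t * g t (w + x + y))))
      (fun w => Real.exp (-c₀ * w) * Real.exp (-s * (w + x + y)))
      (by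
        have := g_meas' (fun p : ℝ × ℝ => p.2) (fun p => p.1 + x + y) (by fun_prop) (by fun_prop)
        unfold Function.uncurry
        fun_prop)
      (by
        intro w hw t ht
        have hw : 0 < w := hw
        have ht : 0 < t := ht
        have := g_nonneg t (w + x + y)
        positivity)
      (by
        filter_upwards [ae_restrict_mem measurableSet_Ioi] with w hw
        have hw : 0 < w := hw
        obtain ⟨k1, k2⟩ := hInt s (w + x + y) hs (by positivity)
        refine ⟨k1.const_mul _, ?_⟩
        rw [integral_const_mul, k2])
      (by
        rw [eF]
        exact (integrableOn_exp_mul_Ioi hn 0).const_mul _)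
  refine ⟨h1, h2.trans ?_⟩
  rw [eF, integral_const_mul, integral_exp_mul_Ioi hn, neg_div_neg_eq]
  simp [div_eq_mul_inv]

lemma C_meas (s c₀ x : ℝ) : Measurable fun p : ℝ × ℝ => ∫ w in Set.Ioi (0:ℝ), Real.exp (-c₀ * w) *
      (Real.exp (-s ^ 2 * p.2) * ((w + x + p.1) / p.2 * g p.2 (w + x + p.1))) := by
  have := g_meas' (fun q : (ℝ × ℝ) × ℝ => q.1.2) (fun q => q.2 + x + q.1.1) (by fun_prop)
    (by fun_prop)
  have hm : Measurable fun q : (ℝ × ℝ) × ℝ => Real.exp (-c₀ * q.2) *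
      (Real.exp (-s ^ 2 * q.1.2) * ((q.2 + x + q.1.1) / q.1.2 * g q.1.2 (q.2 + x + q.1.1))) := by
    fun_prop
  exact (hm.stronglyMeasurable.integral_prod_right' (ν := volume.restrict (Set.Ioi 0))).measurable

lemma lin3 {f1 f2 f3 : ℝ → ℝ} {S : Set ℝ} (h1 : IntegrableOn f1 S) (h2 : IntegrableOn f2 S)
    (h3 : IntegrableOn f3 S) : (∫ t in S, f1 t) - (∫ t in S, f2 t) + ∫ t in S, f3 t
      = ∫ t in S, (f1 t - f2 t + f3 t) := by
  have h12 : IntegrableOn (fun t => f1 t - f2 t) S := h1.sub h2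
  rw [integral_add h12 h3, integral_sub h1 h2]

lemma main_aux (a s c₀ x : ℝ) (ha : 0 ≤ a) (hs : a < s) (hc : 0 ≤ c₀) (hx : 0 ≤ x) :
    ∫ t in Set.Ioi (0:ℝ), ∫ y in Set.Ioi (0:ℝ), Real.exp (a * (x - y)) *
      (Real.exp (-s ^ 2 * t) * p0 c₀ t x y)
      = (1 / (s + a) + (1 - Real.exp (-x * (s - a))) / (s - a)) / (2 * s)
        - Real.exp (-x * (s - a)) / (2 * s) / (s + a)
        + Real.exp (-x * (s - a)) / (c₀ + s) / (s + a) := by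
  have s0 : 0 < s := by linarith
  obtain ⟨fa1, fa2⟩ := FA_int a s x s0 hx (by linarith) (by linarith)
  obtain ⟨fb1, fb2⟩ := FB_int a s x (2 * s) (by linarith)
  obtain ⟨fc1, fc2⟩ := FB_int a s x (c₀ + s) (by linarith)
  obtain ⟨A1, A2, A3⟩ := swap (fun y t => Real.exp (a * (x - y)) *
      (Real.exp (-s ^ 2 * t) * g t (x - y))) _ (by
        have := g_meas' (fun p : ℝ × ℝ => p.2) (fun p => x - p.1) (by fun_prop) (by fun_prop)
        unfold Function.uncurry
        fun_prop) (fun y _ t _ => by have := g_nonneg t (x - y); positivity) (by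
        have hne : ∀ᵐ y ∂(volume.restrict (Set.Ioi (0:ℝ))), y ≠ x :=
          ae_restrict_of_ae (Measure.ae_ne volume x)
        filter_upwards [hne] with y hy
        obtain ⟨k1, k2⟩ := gInt s (x - y) s0 (sub_ne_zero.2 hy.symm)
        refine ⟨k1.const_mul _, ?_⟩
        rw [integral_const_mul, k2]) fa1
  obtain ⟨B1, B2, B3⟩ := swap (fun y t => Real.exp (a * (x - y)) *
      (Real.exp (-s ^ 2 * t) * g t (x + y))) _ (by
        have := g_meas' (fun p : ℝ × ℝ => p.2) (fun p => x + p.1) (by fun_prop) (by fun_prop)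
        unfold Function.uncurry
        fun_prop) (fun y _ t _ => by have := g_nonneg t (x + y); positivity) (by
        filter_upwards [ae_restrict_mem measurableSet_Ioi] with y hy
        have hy : 0 < y := hy
        have hp : 0 < x + y := by linarith
        obtain ⟨k1, k2⟩ := gInt s (x + y) s0 hp.ne'
        refine ⟨k1.const_mul _, ?_⟩
        rw [integral_const_mul, k2, abs_of_pos hp]) fb1
  obtain ⟨C1, C2, C3⟩ := swap (fun y t => Real.exp (a * (x - y)) *
      ∫ w in Set.Ioi (0:ℝ), Real.exp (-c₀ * w) *
      (Real.exp (-s ^ 2 * t) * ((w + x + y) / t * g t (w + x + y)))) _ (by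
        have := C_meas s c₀ x
        unfold Function.uncurry
        fun_prop) (fun y hy t ht => by
        refine mul_nonneg (Real.exp_pos _).le (setIntegral_nonneg measurableSet_Ioi fun w hw => ?_)
        have hy : 0 < y := hy
        have hw : 0 < w := hw
        have ht : 0 < t := ht
        have := g_nonneg t (w + x + y)
        positivity) (by
        filter_upwards [ae_restrict_mem measurableSet_Ioi] with y hy
        obtain ⟨k1, k2⟩ := C_inner s c₀ x y s0 hc hx hy
        refine ⟨k1.const_mul _, ?_⟩
        rw [integral_const_mul, k2]) fc1
  rw [← fa2, ← fb2, ← fc2, ← A2, ← B2, ← C2]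
  rw [lin3 A1 B1 C1]
  refine integral_congr_ae ?_
  filter_upwards [A3, B3, C3] with t a3 b3 c3
  rw [lin3 a3 b3 c3]
  refine integral_congr_ae (Eventually.of_forall fun y => ?_)
  simp only [p0]
  have : ∫ w in Set.Ioi (0:ℝ), Real.exp (-c₀ * w) *
      (Real.exp (-s ^ 2 * t) * ((w + x + y) / t * g t (w + x + y)))
      = Real.exp (-s ^ 2 * t) * ∫ w in Set.Ioi (0:ℝ), Real.exp (-c₀ * w) *
      ((w + x + y) / t) * g t (w + x + y) := by
    rw [← integral_const_mul]
    congr 1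
    funext w
    ring
  rw [this]
  ring

/-- the Laplace transform in time of `u₋(t,x)`, with
`Φ(λ) = √(λ+μ²/4) - μ/2`:
`∫₀^∞ e^{-λt} u₋(t,x) dt = 1/λ - (1/λ)(1 - Φ(λ)/(c₀+μ/2+Φ(λ))) e^{-xΦ(λ)}`. -/
theorem stmt7 (μ c₀ : ℝ) (hμ : 0 ≤ μ) (hc : 0 ≤ c₀) (lam x : ℝ) (hlam : 0 < lam)
    (hx : 0 ≤ x) :
    ∫ t in Set.Ioi (0 : ℝ), Real.exp (-lam * t) * uNeg μ c₀ t x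
      = 1 / lam - 1 / lam *
          (1 - (Real.sqrt (lam + μ ^ 2 / 4) - μ / 2) /
            (c₀ + μ / 2 + (Real.sqrt (lam + μ ^ 2 / 4) - μ / 2))) *
          Real.exp (-x * (Real.sqrt (lam + μ ^ 2 / 4) - μ / 2)) := by
  set s := √(lam + μ ^ 2 / 4) with hs
  have hsq : s ^ 2 = lam + μ ^ 2 / 4 := Real.sq_sqrt (by positivity)
  have hs0 : 0 ≤ s := Real.sqrt_nonneg _
  have hlt : μ / 2 < s := by
    by_contra hcon
    nlinarith [not_lt.1 hcon]
  have e : ∀ t, Real.exp (-lam * t) * uNeg μ c₀ t x = ∫ y in Set.Ioi (0:ℝ),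
      Real.exp (μ / 2 * (x - y)) * (Real.exp (-s ^ 2 * t) * p0 c₀ t x y) := by
    intro t
    unfold uNeg mKer
    rw [← integral_const_mul]
    congr 1
    funext y
    rw [← mul_assoc, ← mul_assoc, ← Real.exp_add, ← Real.exp_add, hsq]
    ring_nf
  simp_rw [e]
  rw [main_aux (μ / 2) s c₀ x (by positivity) hlt hc hx]
  have hl : lam = (s - μ / 2) * (s + μ / 2) := by nlinarith
  generalize Real.exp (-x * (s - μ / 2)) = q
  have n1 : s - μ / 2 ≠ 0 := by linarith
  have n2 : s + μ / 2 ≠ 0 := by linarith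
  have n3 : c₀ + s ≠ 0 := by linarith
  have n4 : s ≠ 0 := by linarith
  rw [show c₀ + μ / 2 + (s - μ / 2) = c₀ + s by ring, hl]
  clear_value s
  clear hl e hsq hs
  generalize ha : μ / 2 = a at *
  field_simp
  ring
end

section
/- Let η ≥ 0, N > 0, ω ≥ 0, and let ψ : [0,∞) → ℝ be continuously differentiable with |ψ(t)| ≤ N e^{ωt} and |ψ′(t)| ≤ N e^{ωt} for all t ≥ 0. Then for every λ > ω with λ > 0, ∫₀^∞ e^{−λt} ( ∫₀^t ψ′(s) Π̄_η(t−s) ds ) dt = Φ(λ) · ∫₀^∞ e^{−λt} ψ(t) dt − (Φ(λ)/λ) · ψ(0), where Φ(λ) = √(λ + η) − √η. -/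
open MeasureTheory Real

lemma gauss_half (a : ℝ) (ha : 0 < a) :
    ∫ t in Set.Ioi (0 : ℝ), t ^ (-(1/2) : ℝ) * Real.exp (-(a * t)) = √π / √a := by
  have h := Real.integral_rpow_mul_exp_neg_mul_Ioi (a := 1/2) (r := a) (by norm_num) ha
  rw [show (1/2 - 1 : ℝ) = -(1/2) by norm_num, Real.Gamma_one_half_eq, ← Real.sqrt_eq_rpow] at h
  rw [h, Real.sqrt_div zero_le_one, Real.sqrt_one]
  ring

lemma half_integrable (a : ℝ) (ha : 0 < a) :
    IntegrableOn (fun t : ℝ => t ^ (-(1/2) : ℝ) * Real.exp (-(a * t))) (Set.Ioi 0) := by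
  have := integrableOn_rpow_mul_exp_neg_mul_rpow (p := 1) (s := -(1/2)) (b := a)
    (by norm_num) (by norm_num) ha
  simpa using this

lemma a_half (a : ℝ) (ha : 0 ≤ a) :
    IntegrableOn (fun t : ℝ => a * (t ^ (-(1/2) : ℝ) * Real.exp (-(a * t)))) (Set.Ioi 0) ∧
    ∫ t in Set.Ioi (0 : ℝ), a * (t ^ (-(1/2) : ℝ) * Real.exp (-(a * t))) = √π * √a := by
  rcases ha.eq_or_lt with rfl | h
  · simp
  · refine ⟨(half_integrable a h).const_mul a, ?_⟩
    rw [integral_const_mul, gauss_half a h]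
    have : √a ≠ 0 := (Real.sqrt_pos.2 h).ne'
    field_simp
    rw [Real.sq_sqrt ha]

lemma diff_bound (η lam t : ℝ) (hη : 0 ≤ η) (hl : 0 < lam) (ht : 0 ≤ t) :
    0 ≤ Real.exp (-(η * t)) - Real.exp (-((lam + η) * t)) ∧
    Real.exp (-(η * t)) - Real.exp (-((lam + η) * t)) ≤ lam * t ∧
    Real.exp (-(η * t)) - Real.exp (-((lam + η) * t)) ≤ 1 := by
  have h1 : Real.exp (-((lam + η) * t)) = Real.exp (-(η * t)) * Real.exp (-(lam * t)) := by
    rw [← Real.exp_add]; ring_nf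
  have h2 : Real.exp (-(η * t)) ≤ 1 := Real.exp_le_one_iff.2 (by nlinarith [mul_nonneg hη ht])
  have h3 : Real.exp (-(lam * t)) ≤ 1 :=
    Real.exp_le_one_iff.2 (by nlinarith [mul_nonneg hl.le ht])
  have h4 := Real.add_one_le_exp (-(lam * t))
  have h5 := Real.exp_pos (-(η * t))
  have h6 := Real.exp_pos (-(lam * t))
  have h7 := mul_nonneg hl.le ht
  rw [h1]
  refine ⟨by nlinarith, by nlinarith, by nlinarith⟩

lemma diff_int (η lam : ℝ) (hη : 0 ≤ η) (hl : 0 < lam) :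
    IntegrableOn (fun t : ℝ => (Real.exp (-(η * t)) - Real.exp (-((lam + η) * t))) *
      t ^ (-(3/2) : ℝ)) (Set.Ioi 0) := by
  have hm : Measurable (fun t : ℝ => (Real.exp (-(η * t)) - Real.exp (-((lam + η) * t))) *
      t ^ (-(3/2) : ℝ)) := by fun_prop
  rw [← Set.Ioc_union_Ioi_eq_Ioi (zero_le_one' ℝ), integrableOn_union]
  constructor
  · have h := (intervalIntegral.intervalIntegrable_rpow' (a := 0) (b := 1)
      (r := -(1/2)) (by norm_num))
    rw [intervalIntegrable_iff_integrableOn_Ioc_of_le zero_le_one] at h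
    refine Integrable.mono' (h.const_mul lam) hm.aestronglyMeasurable ?_
    refine (ae_restrict_iff' measurableSet_Ioc).2 (ae_of_all _ fun t ht => ?_)
    have h0 := diff_bound η lam t hη hl ht.1.le
    have hp : (0:ℝ) < t ^ (-(3/2) : ℝ) := Real.rpow_pos_of_pos ht.1 _
    rw [Real.norm_eq_abs, abs_of_nonneg (mul_nonneg h0.1 hp.le)]
    have : t ^ (-(1/2) : ℝ) = t * t ^ (-(3/2) : ℝ) := by
      rw [← Real.rpow_one_add' ht.1.le (by norm_num)]; norm_num
    rw [this, ← mul_assoc]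
    exact mul_le_mul_of_nonneg_right h0.2.1 hp.le
  · have h := integrableOn_Ioi_rpow_of_lt (a := -(3/2)) (c := 1) (by norm_num) one_pos
    refine Integrable.mono' h hm.aestronglyMeasurable ?_
    refine (ae_restrict_iff' measurableSet_Ioi).2 (ae_of_all _ fun t ht => ?_)
    have ht0 : (0:ℝ) < t := one_pos.trans ht
    have h0 := diff_bound η lam t hη hl ht0.le
    have hp : (0:ℝ) < t ^ (-(3/2) : ℝ) := Real.rpow_pos_of_pos ht0 _
    rw [Real.norm_eq_abs, abs_of_nonneg (mul_nonneg h0.1 hp.le)]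
    nlinarith [h0.2.2]

lemma diff_val (η lam : ℝ) (hη : 0 ≤ η) (hl : 0 < lam) :
    ∫ t in Set.Ioi (0 : ℝ), (Real.exp (-(η * t)) - Real.exp (-((lam + η) * t))) *
      t ^ (-(3/2) : ℝ) = 2 * √π * (√(lam + η) - √η) := by
  obtain ⟨i1, v1⟩ := a_half η hη
  obtain ⟨i2, v2⟩ := a_half (lam + η) (by linarith)
  have i3 := diff_int η lam hη hl
  have key := integral_Ioi_of_hasDerivAt_of_tendsto (a := 0) (m := 0)
    (f := fun t : ℝ => (Real.exp (-(η * t)) - Real.exp (-((lam + η) * t))) * t ^ (-(1/2) : ℝ))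
    (f' := fun t : ℝ => ((lam + η) * (t ^ (-(1/2) : ℝ) * Real.exp (-((lam + η) * t)))
      - η * (t ^ (-(1/2) : ℝ) * Real.exp (-(η * t))))
      - (1/2) * ((Real.exp (-(η * t)) - Real.exp (-((lam + η) * t))) * t ^ (-(3/2) : ℝ)))
    ?_ ?_ ((i2.sub i1).sub (i3.const_mul _)) ?_
  · have i12 : IntegrableOn (fun t : ℝ => (lam + η) * (t ^ (-(1/2) : ℝ) *
        Real.exp (-((lam + η) * t))) - η * (t ^ (-(1/2) : ℝ) * Real.exp (-(η * t))))
        (Set.Ioi 0) := i2.sub i1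
    rw [integral_sub i12 (i3.const_mul _), integral_sub i2 i1, v1, v2, integral_const_mul] at key
    simp only [mul_zero, neg_zero, sub_self, zero_mul] at key
    linarith
  · rw [ContinuousWithinAt]
    have hb : Filter.Tendsto (fun t : ℝ => lam * t ^ (1/2 : ℝ)) (nhdsWithin 0 (Set.Ici 0))
        (nhds 0) := by
      have : ContinuousAt (fun t : ℝ => lam * t ^ (1/2 : ℝ)) 0 :=
        continuousAt_const.mul (Real.continuousAt_rpow_const _ _ (Or.inr (by norm_num)))
      have h2 := this.tendsto.mono_left (nhdsWithin_le_nhds (s := Set.Ici 0))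
      simpa using h2
    have h00 : (Real.exp (-(η * 0)) - Real.exp (-((lam + η) * 0))) * (0:ℝ) ^ (-(1/2) : ℝ) = 0 := by
      simp
    rw [h00]
    refine tendsto_of_tendsto_of_tendsto_of_le_of_le' tendsto_const_nhds hb ?_ ?_
    · filter_upwards [self_mem_nhdsWithin] with t ht
      exact mul_nonneg (diff_bound η lam t hη hl ht).1 (Real.rpow_nonneg ht _)
    · filter_upwards [self_mem_nhdsWithin] with t ht
      have : t ^ (1/2 : ℝ) = t * t ^ (-(1/2) : ℝ) := by
        rw [← Real.rpow_one_add' ht (by norm_num)]; norm_num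
      rw [this, ← mul_assoc]
      exact mul_le_mul_of_nonneg_right (diff_bound η lam t hη hl ht).2.1 (Real.rpow_nonneg ht _)
  · intro t ht
    have ht0 : (0:ℝ) < t := ht
    have d1 : ∀ a : ℝ, HasDerivAt (fun t : ℝ => Real.exp (-(a * t)))
        (Real.exp (-(a * t)) * (-(a * 1))) t := fun a =>
      (((hasDerivAt_id t).const_mul a).neg).exp
    have d2 := Real.hasDerivAt_rpow_const (x := t) (p := -(1/2)) (Or.inl ht0.ne')
    refine (((d1 η).sub (d1 (lam + η))).mul d2).congr_deriv ?_
    rw [show (-(1/2) - 1 : ℝ) = -(3/2) by norm_num]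
    simp only [Pi.sub_apply]
    ring
  · have hb : Filter.Tendsto (fun t : ℝ => t ^ (-(1/2) : ℝ)) Filter.atTop (nhds 0) :=
      tendsto_rpow_neg_atTop (by norm_num)
    refine tendsto_of_tendsto_of_tendsto_of_le_of_le' tendsto_const_nhds hb ?_ ?_
    · filter_upwards [Filter.eventually_ge_atTop 0] with t ht
      exact mul_nonneg (diff_bound η lam t hη hl ht).1 (Real.rpow_nonneg ht _)
    · filter_upwards [Filter.eventually_ge_atTop 0] with t ht
      have := mul_le_mul_of_nonneg_right (diff_bound η lam t hη hl ht).2.2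
        (Real.rpow_nonneg ht (-(1/2)))
      linarith

/-- the Levy density -/
noncomputable def kden (η s : ℝ) : ℝ :=
  Real.exp (-η * s) / (2 * Real.sqrt Real.pi * s ^ ((3 : ℝ) / 2))

lemma kden_meas (η : ℝ) : Measurable (kden η) := by unfold kden; fun_prop

lemma kden_nonneg (η s : ℝ) (hs : 0 < s) : 0 ≤ kden η s := by unfold kden; positivity

lemma exp_int (lam s : ℝ) (hl : 0 < lam) :
    ∫ z in (0:ℝ)..s, Real.exp (-lam * z) = (1 - Real.exp (-(lam * s))) / lam := by
  rw [intervalIntegral.integral_comp_mul_left (fun x => Real.exp x) (neg_ne_zero.2 hl.ne'),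
    integral_exp, mul_zero, Real.exp_zero, neg_mul, smul_eq_mul, inv_neg]
  ring

/-- kernel -/
noncomputable def Kker (η lam : ℝ) (p : ℝ × ℝ) : ℝ :=
  {p : ℝ × ℝ | p.1 < p.2}.indicator (fun p => Real.exp (-lam * p.1) * kden η p.2) p

lemma Kker_meas (η lam : ℝ) : Measurable (Kker η lam) := by
  have := kden_meas η
  exact Measurable.indicator (by fun_prop) (measurableSet_lt measurable_fst measurable_snd)

lemma Kker_sec (η lam s : ℝ) (hl : 0 < lam) (hs : 0 < s) :
    ∫ z in Set.Ioi (0:ℝ), Kker η lam (z, s) = (1 - Real.exp (-(lam * s))) / lam * kden η s := by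
  have : ∀ z, Kker η lam (z, s) =
      (Set.Iio s).indicator (fun z => Real.exp (-lam * z) * kden η s) z := by
    intro z; simp [Kker, Set.indicator_apply]
  simp_rw [this]
  rw [setIntegral_indicator measurableSet_Iio, Set.Ioi_inter_Iio, integral_mul_const,
    ← exp_int lam s hl, intervalIntegral.integral_of_le hs.le, integral_Ioc_eq_integral_Ioo]

lemma kden_diff (η lam s : ℝ) (hs : 0 < s) :
    (1 - Real.exp (-(lam * s))) / lam * kden η s = (1 / (2 * √π * lam)) *
      ((Real.exp (-(η * s)) - Real.exp (-((lam + η) * s))) * s ^ (-(3/2) : ℝ)) := by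
  have h1 : Real.exp (-((lam + η) * s)) = Real.exp (-(η * s)) * Real.exp (-(lam * s)) := by
    rw [← Real.exp_add]; ring_nf
  rw [h1, Real.rpow_neg hs.le, kden, neg_mul]
  have : (0:ℝ) < s ^ ((3:ℝ)/2) := Real.rpow_pos_of_pos hs _
  field_simp

lemma Kker_integrable (η lam : ℝ) (hη : 0 ≤ η) (hl : 0 < lam) :
    Integrable (Kker η lam)
      ((volume.restrict (Set.Ioi (0:ℝ))).prod (volume.restrict (Set.Ioi (0:ℝ)))) := by
  rw [integrable_prod_iff' (Kker_meas η lam).aestronglyMeasurable]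
  constructor
  · refine (ae_restrict_iff' measurableSet_Ioi).2 (ae_of_all _ fun s hs => ?_)
    have h := (integrableOn_exp_mul_Ioi (a := -lam) (by linarith) 0).mul_const (kden η s)
    refine h.mono ((Kker_meas η lam).comp measurable_prodMk_right).aestronglyMeasurable
      (ae_of_all _ fun z => ?_)
    exact norm_indicator_le_norm_self _ _
  · have h := (diff_int η lam hη hl).const_mul (1 / (2 * √π * lam))
    refine h.congr ?_
    refine (ae_restrict_iff' measurableSet_Ioi).2 (ae_of_all _ fun s hs => ?_)
    simp only
    rw [← kden_diff η lam s hs, ← Kker_sec η lam s hl hs]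
    refine integral_congr_ae (ae_of_all _ fun z => ?_)
    simp only
    rw [Real.norm_of_nonneg]
    exact Set.indicator_apply_nonneg fun _ => mul_nonneg (Real.exp_pos _).le (kden_nonneg η s hs)

lemma PiBar_K (η lam z : ℝ) (hz : 0 < z) :
    ∫ s in Set.Ioi (0:ℝ), Kker η lam (z, s) = Real.exp (-lam * z) * PiBar η z := by
  have : ∀ s, Kker η lam (z, s) =
      (Set.Ioi z).indicator (fun s => Real.exp (-lam * z) * kden η s) s := by
    intro s; simp [Kker, Set.indicator_apply]
  simp_rw [this]
  rw [setIntegral_indicator measurableSet_Ioi, Set.Ioi_inter_Ioi, max_eq_right hz.le,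
    integral_const_mul]
  rfl

lemma PiBar_laplace (η lam : ℝ) (hη : 0 ≤ η) (hl : 0 < lam) :
    IntegrableOn (fun z => Real.exp (-lam * z) * PiBar η z) (Set.Ioi 0) ∧
    ∫ z in Set.Ioi (0:ℝ), Real.exp (-lam * z) * PiBar η z = (√(lam + η) - √η) / lam := by
  have hK := Kker_integrable η lam hη hl
  constructor
  · refine hK.integral_prod_left.congr ?_
    refine (ae_restrict_iff' measurableSet_Ioi).2 (ae_of_all _ fun z hz => ?_)
    exact PiBar_K η lam z hz
  · rw [← setIntegral_congr_fun measurableSet_Ioi (fun z hz => PiBar_K η lam z hz)]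
    rw [integral_integral_swap (f := fun z s => Kker η lam (z, s)) hK]
    rw [setIntegral_congr_fun measurableSet_Ioi (fun s hs =>
      (Kker_sec η lam s hl hs).trans (kden_diff η lam s hs)), integral_const_mul,
      diff_val η lam hη hl]
    have : √π ≠ 0 := (Real.sqrt_pos.2 Real.pi_pos).ne'
    field_simp

lemma exp_bdd_int (N ω lam : ℝ) (hlam : ω < lam) (f : ℝ → ℝ)
    (hf : ContinuousOn f (Set.Ici 0)) (hb : ∀ t ≥ (0:ℝ), |f t| ≤ N * Real.exp (ω * t)) :
    IntegrableOn (fun t => Real.exp (-lam * t) * f t) (Set.Ioi 0) := by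
  have h := (integrableOn_exp_mul_Ioi (a := ω - lam) (by linarith) 0).const_mul N
  refine Integrable.mono' h ?_ ?_
  · refine ContinuousOn.aestronglyMeasurable ?_ measurableSet_Ioi
    exact (by fun_prop : Continuous fun t => Real.exp (-lam * t)).continuousOn.mul
      (hf.mono Set.Ioi_subset_Ici_self)
  · refine (ae_restrict_iff' measurableSet_Ioi).2 (ae_of_all _ fun t ht => ?_)
    have h1 := hb t (le_of_lt ht)
    rw [norm_mul, Real.norm_eq_abs, Real.norm_eq_abs, Real.abs_exp,
      show (ω - lam) * t = -lam * t + ω * t by ring, Real.exp_add]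
    nlinarith [Real.exp_pos (-lam * t)]

/-- the Laplace transform of the tempered Caputo derivative of order
`1/2` of an exponentially bounded, continuously differentiable function `ψ` on
`[0,∞)`: for `λ > ω`, `λ > 0`,
`∫₀^∞ e^{-λt} (∫₀^t ψ'(s) Π̄_η(t-s) ds) dt = Φ(λ) ψ̃(λ) - (Φ(λ)/λ) ψ(0)` with
`Φ(λ) = √(λ+η) - √η`. -/
theorem stmt10 (η N ω : ℝ) (hη : 0 ≤ η) (hN : 0 < N) (hω : 0 ≤ ω)
    (ψ ψ' : ℝ → ℝ)
    (hderiv : ∀ t ≥ (0 : ℝ), HasDerivWithinAt ψ (ψ' t) (Set.Ici 0) t)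
    (hcont : ContinuousOn ψ' (Set.Ici 0))
    (hψbound : ∀ t ≥ (0 : ℝ), |ψ t| ≤ N * Real.exp (ω * t))
    (hψ'bound : ∀ t ≥ (0 : ℝ), |ψ' t| ≤ N * Real.exp (ω * t))
    (lam : ℝ) (hlam : ω < lam) (hlam0 : 0 < lam) :
    ∫ t in Set.Ioi (0 : ℝ), Real.exp (-lam * t) *
        (∫ s in (0 : ℝ)..t, ψ' s * PiBar η (t - s))
      = (Real.sqrt (lam + η) - Real.sqrt η) *
          (∫ t in Set.Ioi (0 : ℝ), Real.exp (-lam * t) * ψ t)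
        - (Real.sqrt (lam + η) - Real.sqrt η) / lam * ψ 0 := by
  have hψc : ContinuousOn ψ (Set.Ici 0) := fun t ht => (hderiv t ht).continuousWithinAt
  have iψ := exp_bdd_int N ω lam hlam ψ hψc hψbound
  have iψ' := exp_bdd_int N ω lam hlam ψ' hcont hψ'bound
  obtain ⟨iP, vP⟩ := PiBar_laplace η lam hη hlam0
  have key := integral_posConvolution (μ := volume) (ν := volume) iψ' iP
    (ContinuousLinearMap.mul ℝ ℝ)
  simp only [ContinuousLinearMap.mul_apply'] at key
  rw [vP] at key
  have hparts : ∫ t in Set.Ioi (0:ℝ), Real.exp (-lam * t) * ψ' t =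
      lam * (∫ t in Set.Ioi (0:ℝ), Real.exp (-lam * t) * ψ t) - ψ 0 := by
    have h := integral_Ioi_of_hasDerivAt_of_tendsto (a := 0) (m := 0)
      (f := fun t : ℝ => Real.exp (-lam * t) * ψ t)
      (f' := fun t : ℝ => Real.exp (-lam * t) * ψ' t - lam * (Real.exp (-lam * t) * ψ t))
      ?_ ?_ (iψ'.sub (iψ.const_mul lam)) ?_
    · rw [integral_sub iψ' (iψ.const_mul lam), integral_const_mul] at h
      simp only [mul_zero, Real.exp_zero, one_mul] at h
      linarith
    · exact (by fun_prop : Continuous fun t => Real.exp (-lam * t)).continuousWithinAt.mul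
        (hψc 0 Set.self_mem_Ici)
    · intro t ht
      have d1 : HasDerivAt (fun t : ℝ => Real.exp (-lam * t))
          (Real.exp (-lam * t) * (-lam * 1)) t := ((hasDerivAt_id t).const_mul (-lam)).exp
      have d2 := (hderiv t (le_of_lt ht)).hasDerivAt (Ici_mem_nhds ht)
      refine (d1.mul d2).congr_deriv ?_
      ring
    · have hb : Filter.Tendsto (fun t : ℝ => N * Real.exp ((ω - lam) * t)) Filter.atTop
          (nhds 0) := by
        have h1 : Filter.Tendsto (fun t : ℝ => (ω - lam) * t) Filter.atTop Filter.atBot :=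
          Filter.tendsto_id.const_mul_atTop_of_neg (by linarith)
        simpa using (Real.tendsto_exp_atBot.comp h1).const_mul N
      refine squeeze_zero_norm' ?_ hb
      filter_upwards [Filter.eventually_ge_atTop 0] with t ht
      have h1 := hψbound t ht
      rw [norm_mul, Real.norm_eq_abs, Real.norm_eq_abs, Real.abs_exp,
        show (ω - lam) * t = -lam * t + ω * t by ring, Real.exp_add]
      nlinarith [Real.exp_pos (-lam * t)]
  rw [hparts] at key
  have hl : ∫ t in Set.Ioi (0 : ℝ), Real.exp (-lam * t) *
        (∫ s in (0 : ℝ)..t, ψ' s * PiBar η (t - s)) =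
      ∫ x in Set.Ioi (0 : ℝ), ∫ t in (0 : ℝ)..x, Real.exp (-lam * t) * ψ' t *
        (Real.exp (-lam * (x - t)) * PiBar η (x - t)) := by
    congr 1
    ext x
    rw [← intervalIntegral.integral_const_mul]
    congr 1
    ext t
    rw [show -lam * x = -lam * t + -lam * (x - t) by ring, Real.exp_add]
    ring
  rw [hl, key]
  field_simp
end
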